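/- arXiv:1803.04730 — 2 statements merged into one kernel-verified Lean document; each statement's English description precedes it below -/
import Mathlib

section
/- Let λ ∈ ℂ with λ ∉ {0, 1, −1}, set q = λ², assume q is not a root of unity, and fix μ ∈ ℂ, μ ≠ 0. Then there exists a unique dual pairing of Hopf algebras ⟨·,·⟩ : U_q(sl2) × SL_q(2,ℂ) → ℂ whose values on generators are ⟨K,a⟩ = λ, ⟨K,d⟩ = λ⁻¹, ⟨K⁻¹,a⟩ = λ⁻¹, ⟨K⁻¹,d⟩ = λ, ⟨E,b⟩ = μ, ⟨F,c⟩ = μ⁻¹, and all other pairings between a generator of U_q(sl2) and a generator of SL_q(2,ℂ) vanish. This pairing satisfies ⟨S(x), f⟩ = ⟨x, S(f)⟩ for all x ∈ U_q(sl2), f ∈ SL_q(2,ℂ), and it is nondegenerate. -/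
noncomputable section

open FreeAlgebra
open scoped TensorProduct

/-- The relations of the quantum enveloping algebra `U_q(sl2)`, with generators
`E = ι ℂ 0`, `F = ι ℂ 1`, `K = ι ℂ 2`, `K⁻¹ = ι ℂ 3`. -/
inductive UqRel (q : ℂ) : FreeAlgebra ℂ (Fin 4) → FreeAlgebra ℂ (Fin 4) → Prop
  | kki : UqRel q (ι ℂ 2 * ι ℂ 3) 1
  | kik : UqRel q (ι ℂ 3 * ι ℂ 2) 1
  | ke : UqRel q (ι ℂ 2 * ι ℂ 0) (q • (ι ℂ 0 * ι ℂ 2))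
  | kf : UqRel q (ι ℂ 2 * ι ℂ 1) (q⁻¹ • (ι ℂ 1 * ι ℂ 2))
  | ef : UqRel q ((q - q⁻¹) • (ι ℂ 0 * ι ℂ 1 - ι ℂ 1 * ι ℂ 0))
      (ι ℂ 2 * ι ℂ 2 - ι ℂ 3 * ι ℂ 3)

/-- The quantum enveloping algebra `U_q(sl2)`. -/
abbrev Uq (q : ℂ) := RingQuot (UqRel q)

/-- The images of the generators `E, F, K, K⁻¹` in `U_q(sl2)`. -/
def ugen (q : ℂ) (i : Fin 4) : Uq q := RingQuot.mkAlgHom ℂ (UqRel q) (ι ℂ i)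

/-- The Manin relations with parameter `q` together with the determinant relation,
defining `SL_q(2,ℂ)` with generators `a = ι ℂ 0`, `b = ι ℂ 1`, `c = ι ℂ 2`,
`d = ι ℂ 3`. -/
inductive SLRel (q : ℂ) : FreeAlgebra ℂ (Fin 4) → FreeAlgebra ℂ (Fin 4) → Prop
  | ab : SLRel q (ι ℂ 0 * ι ℂ 1) (q⁻¹ • (ι ℂ 1 * ι ℂ 0))
  | ac : SLRel q (ι ℂ 0 * ι ℂ 2) (q⁻¹ • (ι ℂ 2 * ι ℂ 0))
  | bd : SLRel q (ι ℂ 1 * ι ℂ 3) (q⁻¹ • (ι ℂ 3 * ι ℂ 1))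
  | cd : SLRel q (ι ℂ 2 * ι ℂ 3) (q⁻¹ • (ι ℂ 3 * ι ℂ 2))
  | bc : SLRel q (ι ℂ 1 * ι ℂ 2) (ι ℂ 2 * ι ℂ 1)
  | ad : SLRel q (ι ℂ 0 * ι ℂ 3 - ι ℂ 3 * ι ℂ 0) ((q⁻¹ - q) • (ι ℂ 1 * ι ℂ 2))
  | det : SLRel q (ι ℂ 0 * ι ℂ 3 - q⁻¹ • (ι ℂ 1 * ι ℂ 2)) 1

/-- `SL_q(2,ℂ)`. -/
abbrev SLq (q : ℂ) := RingQuot (SLRel q)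

/-- The images of the generators `a, b, c, d` in `SL_q(2,ℂ)`. -/
def agen (q : ℂ) (i : Fin 4) : SLq q := RingQuot.mkAlgHom ℂ (SLRel q) (ι ℂ i)

/-- `ΔH` is the comultiplication of `U_q(sl2)`: `Δ(E) = E⊗K + K⁻¹⊗E`,
`Δ(F) = F⊗K + K⁻¹⊗F`, `Δ(K^{±1}) = K^{±1}⊗K^{±1}`. -/
def IsUComul (q : ℂ) (ΔH : Uq q →ₐ[ℂ] (Uq q ⊗[ℂ] Uq q)) : Prop :=
  ΔH (ugen q 0) = ugen q 0 ⊗ₜ[ℂ] ugen q 2 + ugen q 3 ⊗ₜ[ℂ] ugen q 0 ∧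
  ΔH (ugen q 1) = ugen q 1 ⊗ₜ[ℂ] ugen q 2 + ugen q 3 ⊗ₜ[ℂ] ugen q 1 ∧
  ΔH (ugen q 2) = ugen q 2 ⊗ₜ[ℂ] ugen q 2 ∧
  ΔH (ugen q 3) = ugen q 3 ⊗ₜ[ℂ] ugen q 3

/-- `εH` is the counit of `U_q(sl2)`: `ε(E) = ε(F) = 0`, `ε(K^{±1}) = 1`. -/
def IsUCounit (q : ℂ) (εH : Uq q →ₐ[ℂ] ℂ) : Prop :=
  εH (ugen q 0) = 0 ∧ εH (ugen q 1) = 0 ∧ εH (ugen q 2) = 1 ∧ εH (ugen q 3) = 1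

/-- `SH` is the antipode of `U_q(sl2)`: a linear algebra antihomomorphism with
`S(E) = −qE`, `S(F) = −q⁻¹F`, `S(K^{±1}) = K^{∓1}`. -/
def IsUAntipode (q : ℂ) (SH : Uq q →ₗ[ℂ] Uq q) : Prop :=
  (∀ x y : Uq q, SH (x * y) = SH y * SH x) ∧ SH 1 = 1 ∧
  SH (ugen q 0) = (-q) • ugen q 0 ∧ SH (ugen q 1) = (-q⁻¹) • ugen q 1 ∧
  SH (ugen q 2) = ugen q 3 ∧ SH (ugen q 3) = ugen q 2

/-- `ΔA` is the matrix comultiplication of `SL_q(2,ℂ)`. -/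
def IsAComul (q : ℂ) (ΔA : SLq q →ₐ[ℂ] (SLq q ⊗[ℂ] SLq q)) : Prop :=
  ΔA (agen q 0) = agen q 0 ⊗ₜ[ℂ] agen q 0 + agen q 1 ⊗ₜ[ℂ] agen q 2 ∧
  ΔA (agen q 1) = agen q 0 ⊗ₜ[ℂ] agen q 1 + agen q 1 ⊗ₜ[ℂ] agen q 3 ∧
  ΔA (agen q 2) = agen q 2 ⊗ₜ[ℂ] agen q 0 + agen q 3 ⊗ₜ[ℂ] agen q 2 ∧
  ΔA (agen q 3) = agen q 2 ⊗ₜ[ℂ] agen q 1 + agen q 3 ⊗ₜ[ℂ] agen q 3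

/-- `εA` is the counit of `SL_q(2,ℂ)`: `ε(a) = ε(d) = 1`, `ε(b) = ε(c) = 0`. -/
def IsACounit (q : ℂ) (εA : SLq q →ₐ[ℂ] ℂ) : Prop :=
  εA (agen q 0) = 1 ∧ εA (agen q 1) = 0 ∧ εA (agen q 2) = 0 ∧ εA (agen q 3) = 1

/-- `SA` is the antipode of `SL_q(2,ℂ)`: a linear algebra antihomomorphism with
`S(a) = d`, `S(b) = −qb`, `S(c) = −q⁻¹c`, `S(d) = a`. -/
def IsAAntipode (q : ℂ) (SA : SLq q →ₗ[ℂ] SLq q) : Prop :=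
  (∀ x y : SLq q, SA (x * y) = SA y * SA x) ∧ SA 1 = 1 ∧
  SA (agen q 0) = agen q 3 ∧ SA (agen q 1) = (-q) • agen q 1 ∧
  SA (agen q 2) = (-q⁻¹) • agen q 2 ∧ SA (agen q 3) = agen q 0

/-- The pairing on tensor squares induced by a bilinear pairing `B`:
`(x ⊗ y, f ⊗ g) ↦ B x f · B y g`. -/
def pair2 {H A : Type*} [AddCommGroup H] [Module ℂ H] [AddCommGroup A] [Module ℂ A]
    (B : H →ₗ[ℂ] Module.Dual ℂ A) :
    (H ⊗[ℂ] H) →ₗ[ℂ] Module.Dual ℂ (A ⊗[ℂ] A) :=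
  (TensorProduct.dualDistrib ℂ A A).comp (TensorProduct.map B B)

/-- `B` is a dual pairing of the Hopf algebras `H` (with comultiplication `ΔH` and
counit `εH`) and `A` (with comultiplication `ΔA` and counit `εA`):
`⟨xy, f⟩ = Σ⟨x, f₍₁₎⟩⟨y, f₍₂₎⟩`, `⟨x, fg⟩ = Σ⟨x₍₁₎, f⟩⟨x₍₂₎, g⟩`, `⟨1, f⟩ = εA f`,
`⟨x, 1⟩ = εH x`. -/
def IsDualPairing {H A : Type*} [Ring H] [Algebra ℂ H] [Ring A] [Algebra ℂ A]
    (B : H →ₗ[ℂ] Module.Dual ℂ A)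
    (ΔH : H →ₐ[ℂ] (H ⊗[ℂ] H)) (εH : H →ₐ[ℂ] ℂ)
    (ΔA : A →ₐ[ℂ] (A ⊗[ℂ] A)) (εA : A →ₐ[ℂ] ℂ) : Prop :=
  (∀ (x y : H) (f : A), B (x * y) f = pair2 B (x ⊗ₜ[ℂ] y) (ΔA f)) ∧
  (∀ (x : H) (f g : A), B x (f * g) = pair2 B (ΔH x) (f ⊗ₜ[ℂ] g)) ∧
  (∀ f : A, B 1 f = εA f) ∧
  (∀ x : H, B x 1 = εH x)

/-- The table of values of the pairing on generators (rows `E, F, K, K⁻¹`, columns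
`a, b, c, d`): `⟨K,a⟩ = λ`, `⟨K,d⟩ = λ⁻¹`, `⟨K⁻¹,a⟩ = λ⁻¹`, `⟨K⁻¹,d⟩ = λ`,
`⟨E,b⟩ = μ`, `⟨F,c⟩ = μ⁻¹`, all other generator pairings vanish. -/
def vals (l μ : ℂ) : Fin 4 → Fin 4 → ℂ :=
  ![![0, μ, 0, 0], ![0, 0, μ⁻¹, 0], ![l, 0, 0, l⁻¹], ![l⁻¹, 0, 0, l]]

/-! ### Generators and relations -/

/-- Induction principle for algebras given by generators and relations. -/
theorem ringQuot_freeAlgebra_induction {X : Type*}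
    {r : FreeAlgebra ℂ X → FreeAlgebra ℂ X → Prop} {motive : RingQuot r → Prop}
    (scalar : ∀ z : ℂ, motive (algebraMap ℂ (RingQuot r) z))
    (gen : ∀ i, motive (RingQuot.mkAlgHom ℂ r (ι ℂ i)))
    (mul : ∀ x y, motive x → motive y → motive (x * y))
    (add : ∀ x y, motive x → motive y → motive (x + y)) (x : RingQuot r) : motive x := by
  obtain ⟨x, rfl⟩ := RingQuot.mkAlgHom_surjective ℂ r x
  induction x using FreeAlgebra.induction with
  | grade0 z => simpa using scalar z
  | grade1 i => exact gen i
  | mul x y hx hy => simpa using mul _ _ hx hy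
  | add x y hx hy => simpa using add _ _ hx hy

theorem uq_algHom_ext {q : ℂ} {T : Type*} [Semiring T] [Algebra ℂ T] {φ ψ : Uq q →ₐ[ℂ] T}
    (h : ∀ i, φ (ugen q i) = ψ (ugen q i)) : φ = ψ := by
  refine RingQuot.ringQuot_ext' ℂ φ ψ (FreeAlgebra.hom_ext ?_)
  funext i
  exact h i

section UqRelations

variable (q : ℂ)

theorem ugen_K_mul_Kinv : ugen q 2 * ugen q 3 = 1 := by
  simpa [ugen] using RingQuot.mkAlgHom_rel ℂ (UqRel.kki (q := q))

theorem ugen_Kinv_mul_K : ugen q 3 * ugen q 2 = 1 := by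
  simpa [ugen] using RingQuot.mkAlgHom_rel ℂ (UqRel.kik (q := q))

theorem ugen_K_mul_E : ugen q 2 * ugen q 0 = q • (ugen q 0 * ugen q 2) := by
  simpa [ugen] using RingQuot.mkAlgHom_rel ℂ (UqRel.ke (q := q))

theorem ugen_K_mul_F : ugen q 2 * ugen q 1 = q⁻¹ • (ugen q 1 * ugen q 2) := by
  simpa [ugen] using RingQuot.mkAlgHom_rel ℂ (UqRel.kf (q := q))

theorem ugen_E_F_commutator :
    (q - q⁻¹) • (ugen q 0 * ugen q 1 - ugen q 1 * ugen q 0) =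
      ugen q 2 * ugen q 2 - ugen q 3 * ugen q 3 := by
  simpa only [ugen, map_smul, map_sub, map_mul] using
    RingQuot.mkAlgHom_rel ℂ (UqRel.ef (q := q))

end UqRelations

theorem eq_add_smul_of_sub_eq_sub_smul {R A : Type*} [Ring R] [AddCommGroup A] [Module R A]
    {x y z w : A} {r s : R} (hx : x = w + r • z) (hxy : x - y = (r - s) • z) :
    y = w + s • z := by
  rw [sub_smul, hx] at hxy
  rw [← sub_sub_cancel (w + r • z) y, hxy]
  abel

section SLqRelations

variable (q : ℂ)

theorem agen_a_mul_b : agen q 0 * agen q 1 = q⁻¹ • (agen q 1 * agen q 0) := by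
  simpa [agen] using RingQuot.mkAlgHom_rel ℂ (SLRel.ab (q := q))

theorem agen_a_mul_c : agen q 0 * agen q 2 = q⁻¹ • (agen q 2 * agen q 0) := by
  simpa [agen] using RingQuot.mkAlgHom_rel ℂ (SLRel.ac (q := q))

theorem agen_b_mul_d : agen q 1 * agen q 3 = q⁻¹ • (agen q 3 * agen q 1) := by
  simpa [agen] using RingQuot.mkAlgHom_rel ℂ (SLRel.bd (q := q))

theorem agen_c_mul_d : agen q 2 * agen q 3 = q⁻¹ • (agen q 3 * agen q 2) := by
  simpa [agen] using RingQuot.mkAlgHom_rel ℂ (SLRel.cd (q := q))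

theorem agen_b_mul_c : agen q 1 * agen q 2 = agen q 2 * agen q 1 := by
  simpa [agen] using RingQuot.mkAlgHom_rel ℂ (SLRel.bc (q := q))

theorem agen_a_mul_d : agen q 0 * agen q 3 = 1 + q⁻¹ • (agen q 1 * agen q 2) := by
  have h : agen q 0 * agen q 3 - q⁻¹ • (agen q 1 * agen q 2) = 1 := by
    simpa [agen] using RingQuot.mkAlgHom_rel ℂ (SLRel.det (q := q))
  rw [← h]; abel

theorem agen_d_mul_a : agen q 3 * agen q 0 = 1 + q • (agen q 1 * agen q 2) := by
  have h : agen q 0 * agen q 3 - agen q 3 * agen q 0 = (q⁻¹ - q) • (agen q 1 * agen q 2) := by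
    simpa only [agen, map_smul, map_sub, map_mul] using
      RingQuot.mkAlgHom_rel ℂ (SLRel.ad (q := q))
  exact eq_add_smul_of_sub_eq_sub_smul (agen_a_mul_d q) h

end SLqRelations

/-! ### Existence -/

@[simp]
theorem pair2_tmul_tmul {H A : Type*} [AddCommGroup H] [Module ℂ H] [AddCommGroup A] [Module ℂ A]
    (B : H →ₗ[ℂ] Module.Dual ℂ A) (x y : H) (f g : A) :
    pair2 B (x ⊗ₜ[ℂ] y) (f ⊗ₜ[ℂ] g) = B x f * B y g := rfl

/-- The coalgebra structure of `U_q(sl2)`. -/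
abbrev uqCoalgebra {q : ℂ} {ΔH : Uq q →ₐ[ℂ] (Uq q ⊗[ℂ] Uq q)} {εH : Uq q →ₐ[ℂ] ℂ}
    (hΔH : IsUComul q ΔH) (hεH : IsUCounit q εH) : Coalgebra ℂ (Uq q) where
  comul := ΔH.toLinearMap
  counit := εH.toLinearMap
  coassoc := by
    obtain ⟨hE, hF, hK, hK'⟩ := hΔH
    have h : (Algebra.TensorProduct.assoc ℂ ℂ ℂ (Uq q) (Uq q) (Uq q)).toAlgHom.comp
        ((Algebra.TensorProduct.map ΔH (AlgHom.id ℂ (Uq q))).comp ΔH) =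
        (Algebra.TensorProduct.map (AlgHom.id ℂ (Uq q)) ΔH).comp ΔH := by
      apply uq_algHom_ext
      intro i
      fin_cases i <;>
        simp [hE, hF, hK, hK', TensorProduct.add_tmul, TensorProduct.tmul_add, add_assoc]
    ext x
    exact DFunLike.congr_fun h x
  rTensor_counit_comp_comul := by
    obtain ⟨hE, hF, hK, hK'⟩ := hΔH
    obtain ⟨eE, eF, eK, eK'⟩ := hεH
    have h : (Algebra.TensorProduct.map εH (AlgHom.id ℂ (Uq q))).comp ΔH =
        Algebra.TensorProduct.includeRight := by
      apply uq_algHom_ext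
      intro i
      fin_cases i <;> simp [hE, hF, hK, hK', eE, eF, eK, eK']
    ext x
    exact DFunLike.congr_fun h x
  lTensor_counit_comp_comul := by
    obtain ⟨hE, hF, hK, hK'⟩ := hΔH
    obtain ⟨eE, eF, eK, eK'⟩ := hεH
    have h : (Algebra.TensorProduct.map (AlgHom.id ℂ (Uq q)) εH).comp ΔH =
        Algebra.TensorProduct.includeLeft := by
      apply uq_algHom_ext
      intro i
      fin_cases i <;> simp [hE, hF, hK, hK', eE, eF, eK, eK']
    ext x
    exact DFunLike.congr_fun h x

/-- The matrices of `E, F, K, K⁻¹` in the two-dimensional representation. -/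
def fundMatrix (l μ : ℂ) : Fin 4 → Matrix (Fin 2) (Fin 2) ℂ :=
  ![!![0, μ; 0, 0], !![0, 0; μ⁻¹, 0], !![l, 0; 0, l⁻¹], !![l⁻¹, 0; 0, l]]

/-- The two-dimensional representation of `U_q(sl2)`. -/
def fundRep (l μ : ℂ) (hl : l ≠ 0) (hμ : μ ≠ 0) :
    Uq (l ^ 2) →ₐ[ℂ] Matrix (Fin 2) (Fin 2) ℂ :=
  RingQuot.liftAlgHom ℂ ⟨FreeAlgebra.lift ℂ (fundMatrix l μ), by
    intro x y h
    cases h <;> ext i j <;> fin_cases i <;> fin_cases j <;>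
      simp [fundMatrix, Matrix.mul_apply, Fin.sum_univ_two] <;> field_simp
    ring⟩

theorem fundRep_ugen (l μ : ℂ) (hl : l ≠ 0) (hμ : μ ≠ 0) (i : Fin 4) :
    fundRep l μ hl hμ (ugen (l ^ 2) i) = fundMatrix l μ i := by
  rw [fundRep, ugen, RingQuot.liftAlgHom_mkAlgHom_apply, FreeAlgebra.lift_ι_apply]

/-- The action of a tensor product of matrix algebras on the tensor square. -/
def kroneckerHom : (Matrix (Fin 2) (Fin 2) ℂ ⊗[ℂ] Matrix (Fin 2) (Fin 2) ℂ) →ₐ[ℂ]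
    Matrix (Fin 2 × Fin 2) (Fin 2 × Fin 2) (ℂ ⊗[ℂ] ℂ) :=
  (Matrix.kroneckerTMulAlgEquiv (Fin 2) (Fin 2) ℂ ℂ ℂ ℂ).toAlgHom

/-- The tensor square of the two-dimensional representation of `U_q(sl2)`. -/
def fundSq (l μ : ℂ) (hl : l ≠ 0) (hμ : μ ≠ 0)
    (ΔH : Uq (l ^ 2) →ₐ[ℂ] (Uq (l ^ 2) ⊗[ℂ] Uq (l ^ 2))) :
    Uq (l ^ 2) →ₐ[ℂ] Matrix (Fin 2 × Fin 2) (Fin 2 × Fin 2) ℂ :=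
  ((Algebra.TensorProduct.lid ℂ ℂ).toAlgHom.mapMatrix.comp kroneckerHom).comp
    ((Algebra.TensorProduct.map (fundRep l μ hl hμ) (fundRep l μ hl hμ)).comp ΔH)

theorem fundSq_apply (l μ : ℂ) (hl : l ≠ 0) (hμ : μ ≠ 0)
    (ΔH : Uq (l ^ 2) →ₐ[ℂ] (Uq (l ^ 2) ⊗[ℂ] Uq (l ^ 2))) (x : Uq (l ^ 2)) (i j m n : Fin 2) :
    fundSq l μ hl hμ ΔH x (i, m) (j, n) =
      LinearMap.mul' ℂ ℂ (TensorProduct.map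
        (Matrix.entryLinearMap ℂ ℂ i j ∘ₗ (fundRep l μ hl hμ).toLinearMap)
        (Matrix.entryLinearMap ℂ ℂ m n ∘ₗ (fundRep l μ hl hμ).toLinearMap) (ΔH x)) := by
  simp only [fundSq, kroneckerHom, AlgHom.comp_apply]
  induction ΔH x using TensorProduct.induction_on with
  | zero => simp
  | add y z hy hz => simp only [map_add, Matrix.add_apply, hy, hz]
  | tmul y z => simp

/-- The quantum antisymmetric vector. -/
def qAlt (q : ℂ) : Fin 2 × Fin 2 → ℂ := fun p => !![0, 1; -q⁻¹, 0] p.1 p.2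

open Matrix in
theorem fundSq_mulVec_qAlt {l μ : ℂ} (hl : l ≠ 0) (hμ : μ ≠ 0)
    {ΔH : Uq (l ^ 2) →ₐ[ℂ] (Uq (l ^ 2) ⊗[ℂ] Uq (l ^ 2))} {εH : Uq (l ^ 2) →ₐ[ℂ] ℂ}
    (hΔH : IsUComul (l ^ 2) ΔH) (hεH : IsUCounit (l ^ 2) εH) (x : Uq (l ^ 2)) :
    fundSq l μ hl hμ ΔH x *ᵥ qAlt (l ^ 2) = εH x • qAlt (l ^ 2) ∧
    qAlt (l ^ 2) ᵥ* fundSq l μ hl hμ ΔH x = εH x • qAlt (l ^ 2) := by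
  induction x using ringQuot_freeAlgebra_induction with
  | scalar z =>
    simp [Algebra.algebraMap_eq_smul_one, Matrix.smul_mulVec, Matrix.vecMul_smul]
  | gen i =>
    change fundSq l μ hl hμ ΔH (ugen _ i) *ᵥ _ = εH (ugen _ i) • _ ∧
      _ ᵥ* fundSq l μ hl hμ ΔH (ugen _ i) = εH (ugen _ i) • _
    obtain ⟨hE, hF, hK, hK'⟩ := hΔH
    obtain ⟨eE, eF, eK, eK'⟩ := hεH
    constructor <;> ext ⟨a, b⟩ <;> fin_cases i <;> fin_cases a <;> fin_cases b <;>
      simp [Matrix.mulVec, Matrix.vecMul, dotProduct, Fintype.sum_prod_type, Fin.sum_univ_two,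
        fundSq_apply, hE, hF, hK, hK', eE, eF, eK, eK', fundRep_ugen, fundMatrix, qAlt] <;>
      field_simp <;> ring
  | mul x y hx hy =>
    constructor
    · rw [map_mul, map_mul, ← Matrix.mulVec_mulVec, hy.1, Matrix.mulVec_smul, hx.1, smul_smul,
        mul_comm]
    · rw [map_mul, map_mul, ← Matrix.vecMul_vecMul, hx.2, Matrix.smul_vecMul, hy.2, smul_smul]
  | add x y hx hy =>
    constructor
    · rw [map_add, map_add, Matrix.add_mulVec, hx.1, hy.1, add_smul]
    · rw [map_add, map_add, Matrix.vecMul_add, hx.2, hy.2, add_smul]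

/-- The matrix coefficients of the two-dimensional representation, in the order `a, b, c, d`. -/
def fundCoeff (l μ : ℂ) (hl : l ≠ 0) (hμ : μ ≠ 0) (i : Fin 4) : Uq (l ^ 2) →ₗ[ℂ] ℂ :=
  Matrix.entryLinearMap ℂ ℂ (![0, 0, 1, 1] i : Fin 2) (![0, 1, 0, 1] i : Fin 2) ∘ₗ
    (fundRep l μ hl hμ).toLinearMap

open WithConv LinearMap in
/-- The algebra homomorphism from `SL_q(2,ℂ)` to the convolution algebra dual to `U_q(sl2)`
given by the matrix coefficients of the two-dimensional representation. -/
theorem exists_algHom_dual {l μ : ℂ} (hl : l ≠ 0) (hμ : μ ≠ 0)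
    {ΔH : Uq (l ^ 2) →ₐ[ℂ] (Uq (l ^ 2) ⊗[ℂ] Uq (l ^ 2))} {εH : Uq (l ^ 2) →ₐ[ℂ] ℂ}
    (hΔH : IsUComul (l ^ 2) ΔH) (hεH : IsUCounit (l ^ 2) εH) :
    letI := uqCoalgebra hΔH hεH
    ∃ Φ : SLq (l ^ 2) →ₐ[ℂ] WithConv (Uq (l ^ 2) →ₗ[ℂ] ℂ),
      ∀ i, Φ (agen (l ^ 2) i) = toConv (fundCoeff l μ hl hμ i) := by
  let := uqCoalgebra hΔH hεH
  have key : ∀ (i j : Fin 4) (x : Uq (l ^ 2)),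
      (toConv (fundCoeff l μ hl hμ i) * toConv (fundCoeff l μ hl hμ j)) x =
        fundSq l μ hl hμ ΔH x (![0, 0, 1, 1] i, ![0, 0, 1, 1] j)
          (![0, 1, 0, 1] i, ![0, 1, 0, 1] j) := by
    intro i j x
    rw [fundSq_apply]
    rfl
  have hq : l ^ 2 ≠ 0 := pow_ne_zero 2 hl
  refine ⟨RingQuot.liftAlgHom ℂ ⟨FreeAlgebra.lift ℂ fun i => toConv (fundCoeff l μ hl hμ i),
    ?_⟩, fun i => ?_⟩
  · intro f g h
    refine WithConv.ext (LinearMap.ext fun x => ?_)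
    obtain ⟨hr, hc⟩ := fundSq_mulVec_qAlt hl hμ hΔH hεH x
    have r00 := congrFun hr (0, 0)
    have r01 := congrFun hr (0, 1)
    have r10 := congrFun hr (1, 0)
    have r11 := congrFun hr (1, 1)
    have c00 := congrFun hc (0, 0)
    have c01 := congrFun hc (0, 1)
    have c10 := congrFun hc (1, 0)
    have c11 := congrFun hc (1, 1)
    have h1 : (1 : WithConv (Uq (l ^ 2) →ₗ[ℂ] ℂ)) x = εH x := rfl
    simp only [Matrix.mulVec, Matrix.vecMul, dotProduct, Fintype.sum_prod_type, Fin.sum_univ_two,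
      qAlt, Pi.smul_apply, smul_eq_mul, Matrix.of_apply, Matrix.cons_val', Matrix.cons_val_zero,
      Matrix.cons_val_one, Matrix.cons_val_fin_one, mul_zero, mul_one, zero_add, add_zero,
      zero_mul, one_mul] at r00 r01 r10 r11 c00 c01 c10 c11
    cases h <;>
      simp only [map_mul, map_sub, map_smul, map_one, FreeAlgebra.lift_ι_apply, ofConv_sub,
        ofConv_smul, LinearMap.sub_apply, LinearMap.smul_apply, smul_eq_mul, key, h1] <;>
      simp <;> grind
  · rw [agen, RingQuot.liftAlgHom_mkAlgHom_apply, FreeAlgebra.lift_ι_apply]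

/-- The pairing on fourfold tensor powers is compatible with exchanging the middle factors. -/
theorem pair2_pair2_tensorTensorTensorComm {H A : Type*} [AddCommGroup H] [Module ℂ H]
    [AddCommGroup A] [Module ℂ A] (B : H →ₗ[ℂ] Module.Dual ℂ A) (s s' : H ⊗[ℂ] H)
    (t t' : A ⊗[ℂ] A) :
    pair2 (pair2 B) (TensorProduct.tensorTensorTensorComm ℂ H H H H (s ⊗ₜ[ℂ] s')) (t ⊗ₜ[ℂ] t') =
      pair2 (pair2 B) (s ⊗ₜ[ℂ] s')
        (TensorProduct.tensorTensorTensorComm ℂ A A A A (t ⊗ₜ[ℂ] t')) := by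
  induction s using TensorProduct.induction_on with
  | zero => simp
  | add y z hy hz =>
    simp only [TensorProduct.add_tmul, map_add, LinearMap.add_apply, hy, hz]
  | tmul x₁ x₂ =>
  induction s' using TensorProduct.induction_on with
  | zero => simp
  | add y z hy hz =>
    simp only [TensorProduct.tmul_add, map_add, LinearMap.add_apply, hy, hz]
  | tmul y₁ y₂ =>
  induction t using TensorProduct.induction_on with
  | zero => simp
  | add y z hy hz =>
    simp only [TensorProduct.add_tmul, map_add, hy, hz]
  | tmul f₁ f₂ =>
  induction t' using TensorProduct.induction_on with
  | zero => simp
  | add y z hy hz =>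
    simp only [TensorProduct.tmul_add, map_add, hy, hz]
  | tmul g₁ g₂ =>
    simp only [TensorProduct.tensorTensorTensorComm_tmul, pair2_tmul_tmul]
    ring

/-- If a pairing is compatible with the product of `A`, then the elements of `A` on which it is
compatible with the product of `H` are closed under multiplication. -/
theorem pairing_mul_left_of_mul {H A : Type*} [Ring H] [Algebra ℂ H] [Ring A] [Algebra ℂ A]
    {B : H →ₗ[ℂ] Module.Dual ℂ A} {ΔH : H →ₐ[ℂ] (H ⊗[ℂ] H)} {ΔA : A →ₐ[ℂ] (A ⊗[ℂ] A)}
    (hmul : ∀ x f g, B x (f * g) = pair2 B (ΔH x) (f ⊗ₜ[ℂ] g)) {f g : A}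
    (hf : ∀ x y, B (x * y) f = pair2 B (x ⊗ₜ[ℂ] y) (ΔA f))
    (hg : ∀ x y, B (x * y) g = pair2 B (x ⊗ₜ[ℂ] y) (ΔA g)) (x y : H) :
    B (x * y) (f * g) = pair2 B (x ⊗ₜ[ℂ] y) (ΔA (f * g)) := by
  have h₁ : ∀ s s' : H ⊗[ℂ] H, pair2 B (s * s') (f ⊗ₜ[ℂ] g) = pair2 (pair2 B)
      (TensorProduct.tensorTensorTensorComm ℂ H H H H (s ⊗ₜ[ℂ] s')) (ΔA f ⊗ₜ[ℂ] ΔA g) := by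
    intro s s'
    induction s using TensorProduct.induction_on with
    | zero => simp
    | add y z hy hz =>
      simp only [TensorProduct.add_tmul, add_mul, map_add, LinearMap.add_apply, hy, hz]
    | tmul x₁ x₂ =>
    induction s' using TensorProduct.induction_on with
    | zero => simp
    | add y z hy hz =>
      simp only [TensorProduct.tmul_add, mul_add, map_add, LinearMap.add_apply, hy, hz]
    | tmul y₁ y₂ => simp [hf, hg]
  have h₂ : ∀ t t' : A ⊗[ℂ] A, pair2 B (x ⊗ₜ[ℂ] y) (t * t') = pair2 (pair2 B)
      (ΔH x ⊗ₜ[ℂ] ΔH y) (TensorProduct.tensorTensorTensorComm ℂ A A A A (t ⊗ₜ[ℂ] t')) := by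
    intro t t'
    induction t using TensorProduct.induction_on with
    | zero => simp
    | add y z hy hz => simp only [TensorProduct.add_tmul, add_mul, map_add, hy, hz]
    | tmul f₁ f₂ =>
    induction t' using TensorProduct.induction_on with
    | zero => simp
    | add y z hy hz => simp only [TensorProduct.tmul_add, mul_add, map_add, hy, hz]
    | tmul g₁ g₂ => simp [hmul]
  rw [hmul, map_mul, h₁, pair2_pair2_tensorTensorTensorComm, map_mul, h₂]

theorem exists_dualPairing {l μ : ℂ} (hl : l ≠ 0) (hμ : μ ≠ 0)
    {ΔH : Uq (l ^ 2) →ₐ[ℂ] (Uq (l ^ 2) ⊗[ℂ] Uq (l ^ 2))} {εH : Uq (l ^ 2) →ₐ[ℂ] ℂ}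
    {ΔA : SLq (l ^ 2) →ₐ[ℂ] (SLq (l ^ 2) ⊗[ℂ] SLq (l ^ 2))} {εA : SLq (l ^ 2) →ₐ[ℂ] ℂ}
    (hΔH : IsUComul (l ^ 2) ΔH) (hεH : IsUCounit (l ^ 2) εH)
    (hΔA : IsAComul (l ^ 2) ΔA) (hεA : IsACounit (l ^ 2) εA) :
    ∃ B : Uq (l ^ 2) →ₗ[ℂ] Module.Dual ℂ (SLq (l ^ 2)),
      IsDualPairing B ΔH εH ΔA εA ∧
      ∀ i j : Fin 4, B (ugen (l ^ 2) i) (agen (l ^ 2) j) = vals l μ i j := by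
  let := uqCoalgebra hΔH hεH
  obtain ⟨Φ, hΦ⟩ := exists_algHom_dual hl hμ hΔH hεH
  let B : Uq (l ^ 2) →ₗ[ℂ] Module.Dual ℂ (SLq (l ^ 2)) :=
    ((WithConv.linearEquiv ℂ (Uq (l ^ 2) →ₗ[ℂ] ℂ)).toLinearMap ∘ₗ Φ.toLinearMap).flip
  have hB : ∀ x f, B x f = (Φ f).ofConv x := fun x f => rfl
  have hgen : ∀ x i, B x (agen (l ^ 2) i) =
      fundRep l μ hl hμ x (![0, 0, 1, 1] i) (![0, 1, 0, 1] i) := by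
    intro x i
    rw [hB, hΦ]
    rfl
  have hone : ∀ x, B x 1 = εH x := fun x => by
    rw [hB, map_one]
    rfl
  have hmul : ∀ x f g, B x (f * g) = pair2 B (ΔH x) (f ⊗ₜ[ℂ] g) := by
    intro x f g
    have : B x (f * g) = LinearMap.mul' ℂ ℂ
        (TensorProduct.map (Φ f).ofConv (Φ g).ofConv (ΔH x)) := by
      rw [hB, map_mul]
      rfl
    rw [this]
    induction ΔH x using TensorProduct.induction_on with
    | zero => simp
    | tmul y z => simp [hB]
    | add y z hy hz => simp only [map_add, LinearMap.add_apply, hy, hz]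
  refine ⟨B, ⟨?_, hmul, ?_, hone⟩, ?_⟩
  · intro x y f
    induction f using ringQuot_freeAlgebra_induction generalizing x y with
    | scalar z =>
      simp [Algebra.algebraMap_eq_smul_one, hone, Algebra.TensorProduct.one_def]
    | gen i =>
      change B (x * y) (agen _ i) = pair2 B (x ⊗ₜ[ℂ] y) (ΔA (agen _ i))
      obtain ⟨h0, h1, h2, h3⟩ := hΔA
      rw [hgen, map_mul, Matrix.mul_apply, Fin.sum_univ_two]
      fin_cases i <;> simp [h0, h1, h2, h3, hgen]
    | mul f g hf hg => exact pairing_mul_left_of_mul hmul hf hg x y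
    | add f g hf hg => simp only [map_add, hf, hg]
  · intro f
    induction f using ringQuot_freeAlgebra_induction with
    | scalar z => simp [Algebra.algebraMap_eq_smul_one, hone]
    | gen i =>
      change B 1 (agen _ i) = εA (agen _ i)
      rw [hgen]
      obtain ⟨h0, h1, h2, h3⟩ := hεA
      fin_cases i <;> simp [h0, h1, h2, h3]
    | mul f g hf hg => rw [hmul, map_one, map_mul, ← hf, ← hg]; rfl
    | add f g hf hg => rw [map_add, map_add, hf, hg]
  · intro i j
    rw [hgen, fundRep_ugen]
    fin_cases i <;> fin_cases j <;> simp [fundMatrix, vals]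

/-! ### Uniqueness -/

theorem dualPairing_ext {q : ℂ}
    {ΔH : Uq q →ₐ[ℂ] (Uq q ⊗[ℂ] Uq q)} {εH : Uq q →ₐ[ℂ] ℂ}
    {ΔA : SLq q →ₐ[ℂ] (SLq q ⊗[ℂ] SLq q)} {εA : SLq q →ₐ[ℂ] ℂ}
    (hΔH : IsUComul q ΔH)
    {B B' : Uq q →ₗ[ℂ] Module.Dual ℂ (SLq q)}
    (hB : IsDualPairing B ΔH εH ΔA εA) (hB' : IsDualPairing B' ΔH εH ΔA εA)
    (h : ∀ i j : Fin 4, B (ugen q i) (agen q j) = B' (ugen q i) (agen q j)) : B = B' := by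
  obtain ⟨hmulH, hmulA, hεA, hεH⟩ := hB
  obtain ⟨hmulH', hmulA', hεA', hεH'⟩ := hB'
  have hgen : ∀ (f : SLq q) (i : Fin 4), B (ugen q i) f = B' (ugen q i) f := by
    intro f
    induction f using ringQuot_freeAlgebra_induction with
    | scalar z => simp [Algebra.algebraMap_eq_smul_one, hεH, hεH']
    | gen j => exact fun i => h i j
    | mul f g hf hg =>
      obtain ⟨hE, hF, hK, hK'⟩ := hΔH
      intro i
      fin_cases i <;> simp [hmulA, hmulA', hE, hF, hK, hK', hf, hg]
    | add f g hf hg => intro i; simp only [map_add, hf, hg]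
  ext x f
  induction x using ringQuot_freeAlgebra_induction generalizing f with
  | scalar z => simp [Algebra.algebraMap_eq_smul_one, hεA, hεA']
  | gen i => exact hgen f i
  | mul x y hx hy =>
    rw [hmulH, hmulH']
    induction ΔA f using TensorProduct.induction_on with
    | zero => simp
    | tmul f₁ f₂ => simp [hx, hy]
    | add t t' ht ht' => simp only [map_add, ht, ht']
  | add x y hx hy => simp only [map_add, LinearMap.add_apply, hx, hy]

/-! ### Compatibility with the antipodes -/

/-- The antipode of `SL_q(2,ℂ)` reverses the comultiplication. -/
theorem comul_antipode {q : ℂ} (hq : q ≠ 0) {ΔA : SLq q →ₐ[ℂ] (SLq q ⊗[ℂ] SLq q)}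
    {SA : SLq q →ₗ[ℂ] SLq q} (hΔA : IsAComul q ΔA) (hSA : IsAAntipode q SA) (f : SLq q) :
    ΔA (SA f) = TensorProduct.map SA SA (TensorProduct.comm ℂ (SLq q) (SLq q) (ΔA f)) := by
  obtain ⟨hmul, hone, ha, hb, hc, hd⟩ := hSA
  have hanti : ∀ t t' : SLq q ⊗[ℂ] SLq q,
      TensorProduct.map SA SA (TensorProduct.comm ℂ (SLq q) (SLq q) (t * t')) =
        TensorProduct.map SA SA (TensorProduct.comm ℂ (SLq q) (SLq q) t') *
          TensorProduct.map SA SA (TensorProduct.comm ℂ (SLq q) (SLq q) t) := by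
    intro t t'
    induction t using TensorProduct.induction_on with
    | zero => simp
    | add y z hy hz => simp only [add_mul, mul_add, map_add, hy, hz]
    | tmul f₁ f₂ =>
    induction t' using TensorProduct.induction_on with
    | zero => simp
    | add y z hy hz => simp only [add_mul, mul_add, map_add, hy, hz]
    | tmul g₁ g₂ => simp [hmul]
  induction f using ringQuot_freeAlgebra_induction with
  | scalar z => simp [Algebra.algebraMap_eq_smul_one, hone, Algebra.TensorProduct.one_def]
  | gen i =>
    change ΔA (SA (agen q i)) =
      TensorProduct.map SA SA (TensorProduct.comm ℂ (SLq q) (SLq q) (ΔA (agen q i)))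
    obtain ⟨h0, h1, h2, h3⟩ := hΔA
    have hs : ∀ x y : SLq q, ((-q) • x) ⊗ₜ[ℂ] ((-q⁻¹) • y) = x ⊗ₜ[ℂ] y := by
      intro x y
      rw [TensorProduct.smul_tmul_smul, neg_mul_neg, mul_inv_cancel₀ hq, one_smul]
    have hs' : ∀ x y : SLq q, ((-q⁻¹) • x) ⊗ₜ[ℂ] ((-q) • y) = x ⊗ₜ[ℂ] y := by
      intro x y
      rw [TensorProduct.smul_tmul_smul, neg_mul_neg, inv_mul_cancel₀ hq, one_smul]
    fin_cases i <;>
      simp only [Fin.zero_eta, Fin.mk_one, Fin.reduceFinMk, h0, h1, h2, h3, ha, hb, hc, hd, hs, hs',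
        map_add, map_smul, TensorProduct.comm_tmul, TensorProduct.map_tmul, smul_add,
        TensorProduct.smul_tmul', TensorProduct.tmul_smul] <;>
      rw [add_comm]
  | mul f g hf hg => rw [hmul, map_mul, hf, hg, map_mul, hanti]
  | add f g hf hg => simp only [map_add, hf, hg]

theorem dualPairing_antipode {l μ : ℂ} (hl : l ≠ 0)
    {ΔH : Uq (l ^ 2) →ₐ[ℂ] (Uq (l ^ 2) ⊗[ℂ] Uq (l ^ 2))} {εH : Uq (l ^ 2) →ₐ[ℂ] ℂ}
    {SH : Uq (l ^ 2) →ₗ[ℂ] Uq (l ^ 2)}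
    {ΔA : SLq (l ^ 2) →ₐ[ℂ] (SLq (l ^ 2) ⊗[ℂ] SLq (l ^ 2))} {εA : SLq (l ^ 2) →ₐ[ℂ] ℂ}
    {SA : SLq (l ^ 2) →ₗ[ℂ] SLq (l ^ 2)}
    (hΔH : IsUComul (l ^ 2) ΔH) (hεH : IsUCounit (l ^ 2) εH) (hSH : IsUAntipode (l ^ 2) SH)
    (hΔA : IsAComul (l ^ 2) ΔA) (hεA : IsACounit (l ^ 2) εA) (hSA : IsAAntipode (l ^ 2) SA)
    {B : Uq (l ^ 2) →ₗ[ℂ] Module.Dual ℂ (SLq (l ^ 2))} (hB : IsDualPairing B ΔH εH ΔA εA)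
    (hv : ∀ i j : Fin 4, B (ugen (l ^ 2) i) (agen (l ^ 2) j) = vals l μ i j)
    (x : Uq (l ^ 2)) (f : SLq (l ^ 2)) : B (SH x) f = B x (SA f) := by
  have hcomul := comul_antipode (pow_ne_zero 2 hl) hΔA hSA
  obtain ⟨hmulH, hmulA, hpA, hpH⟩ := hB
  obtain ⟨sAmul, sAone, sa, sb, sc, sd⟩ := hSA
  obtain ⟨sHmul, sHone, sE, sF, sK, sK'⟩ := hSH
  have hgen : ∀ (f : SLq (l ^ 2)) (i : Fin 4), B (SH (ugen _ i)) f = B (ugen _ i) (SA f) := by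
    intro f
    induction f using ringQuot_freeAlgebra_induction with
    | scalar z =>
      obtain ⟨eE, eF, eK, eK'⟩ := hεH
      intro i
      fin_cases i <;>
        simp [Algebra.algebraMap_eq_smul_one, sAone, hpH, sE, sF, sK, sK', eE, eF, eK, eK']
    | gen j =>
      change ∀ i, B (SH (ugen _ i)) (agen _ j) = B (ugen _ i) (SA (agen _ j))
      intro i
      fin_cases i <;> fin_cases j <;>
        simp [sE, sF, sK, sK', sa, sb, sc, sd, hv, vals]
    | mul f g hf hg =>
      obtain ⟨hE, hF, hK, hK'⟩ := hΔH
      intro i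
      have f0 := hf 0
      have f1 := hf 1
      have f2 := hf 2
      have f3 := hf 3
      have g0 := hg 0
      have g1 := hg 1
      have g2 := hg 2
      have g3 := hg 3
      rw [sAmul]
      simp only [sE, sF, sK, sK', map_smul, LinearMap.smul_apply, smul_eq_mul]
        at f0 f1 f2 f3 g0 g1 g2 g3
      fin_cases i <;>
        simp [sE, sF, sK, sK', hmulA, hE, hF, hK, hK', ← f0, ← f1, ← f2, ← f3, ← g0, ← g1, ← g2,
          ← g3] <;> ring
    | add f g hf hg => intro i; simp only [map_add, hf, hg]
  have hεS : ∀ f, B 1 (SA f) = B 1 f := by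
    intro f
    rw [hpA, hpA]
    induction f using ringQuot_freeAlgebra_induction with
    | scalar z => simp [Algebra.algebraMap_eq_smul_one, sAone]
    | gen j =>
      change εA (SA (agen _ j)) = εA (agen _ j)
      obtain ⟨h0, h1, h2, h3⟩ := hεA
      fin_cases j <;> simp [sa, sb, sc, sd, h0, h1, h2, h3]
    | mul f g hf hg => rw [sAmul, map_mul, map_mul, hf, hg, mul_comm]
    | add f g hf hg => simp only [map_add, hf, hg]
  induction x using ringQuot_freeAlgebra_induction generalizing f with
  | scalar z => simp [Algebra.algebraMap_eq_smul_one, sHone, hεS]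
  | gen i => exact hgen f i
  | mul x y hx hy =>
    rw [sHmul, hmulH, hmulH, hcomul]
    induction ΔA f using TensorProduct.induction_on with
    | zero => simp
    | tmul f₁ f₂ => simp [hx, hy, mul_comm]
    | add t t' ht ht' => simp only [map_add, ht, ht']
  | add x y hx hy => simp only [map_add, LinearMap.add_apply, hx, hy]

/-! ### Spanning sets of ordered monomials -/

/-- A submodule stable under left multiplication by a generating set and containing `1` is
everything. -/
theorem submodule_eq_top_of_mul_mem {A : Type*} [Ring A] [Algebra ℂ A] {s : Set A}
    (hs : Algebra.adjoin ℂ s = ⊤) {M : Submodule ℂ A} (hone : 1 ∈ M)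
    (hM : ∀ x ∈ s, ∀ m ∈ M, x * m ∈ M) : M = ⊤ := by
  have h : ∀ x : A, ∀ m ∈ M, x * m ∈ M := by
    intro x
    have hx : x ∈ Algebra.adjoin ℂ s := hs ▸ Algebra.mem_top
    induction hx using Algebra.adjoin_induction with
    | mem x hx => exact hM x hx
    | algebraMap z =>
      intro m hm
      rw [← Algebra.smul_def]
      exact M.smul_mem z hm
    | add x y _ _ hx hy =>
      intro m hm
      rw [add_mul]
      exact M.add_mem (hx m hm) (hy m hm)
    | mul x y _ _ hx hy =>
      intro m hm
      rw [mul_assoc]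
      exact hx _ (hy m hm)
  exact eq_top_iff.mpr fun x _ => by simpa using h x 1 hone

theorem mul_mem_span_of_forall {A ι' : Type*} [Ring A] [Algebra ℂ A] {v : ι' → A} {x : A}
    (h : ∀ p, x * v p ∈ Submodule.span ℂ (Set.range v)) :
    ∀ m ∈ Submodule.span ℂ (Set.range v), x * m ∈ Submodule.span ℂ (Set.range v) := by
  intro m hm
  induction hm using Submodule.span_induction with
  | mem y hy => obtain ⟨p, rfl⟩ := hy; exact h p
  | zero => simp
  | add y z _ _ hy hz => rw [mul_add]; exact add_mem hy hz
  | smul z y _ hy => rw [mul_smul_comm]; exact Submodule.smul_mem _ z hy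

/-- Powers of `y` pass a `q`-commuting element `x`. -/
theorem mul_pow_of_mul_eq_smul {A : Type*} [Ring A] [Algebra ℂ A] {x y : A} {z : ℂ}
    (h : x * y = z • (y * x)) (n : ℕ) : x * y ^ n = z ^ n • (y ^ n * x) := by
  induction n with
  | zero => simp
  | succ n ih =>
    rw [pow_succ, ← mul_assoc, ih, smul_mul_assoc, mul_assoc, h, mul_smul_comm, smul_smul,
      mul_assoc, pow_succ]

theorem mul_eq_inv_smul_of_mul_eq_smul {A : Type*} [Ring A] [Algebra ℂ A] {x y : A} {z : ℂ}
    (hz : z ≠ 0) (h : x * y = z • (y * x)) : y * x = z⁻¹ • (x * y) := by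
  rw [h, smul_smul, inv_mul_cancel₀ hz, one_smul]

/-- Elements `E`, `F`, `K` generating an algebra and satisfying the relations of `U_q(sl2)`. -/
structure IsUqGenerated {H : Type*} [Ring H] [Algebra ℂ H] (q : ℂ) (E F : H) (K : Hˣ) : Prop where
  K_mul_E : K * E = q • (E * K)
  K_mul_F : K * F = q⁻¹ • (F * K)
  commutator : (q - q⁻¹) • (E * F - F * E) = K * K - ↑K⁻¹ * ↑K⁻¹
  adjoin_eq_top : Algebra.adjoin ℂ {E, F, (K : H), (↑K⁻¹ : H)} = ⊤

theorem Units.inv_mul_eq_smul {H : Type*} [Ring H] [Algebra ℂ H] {K : Hˣ} {x : H} {z : ℂ}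
    (hz : z ≠ 0) (h : K * x = z • (x * K)) : ↑K⁻¹ * x = z⁻¹ • (x * ↑K⁻¹) := by
  have : x = z • (↑K⁻¹ * x * K) := by
    rw [mul_assoc, ← mul_smul_comm, ← h, Units.inv_mul_cancel_left]
  conv_rhs => rw [this]
  rw [smul_mul_assoc, Units.mul_inv_cancel_right, smul_smul, inv_mul_cancel₀ hz, one_smul]

theorem mul_zpow_of_mul_eq_smul {H : Type*} [Ring H] [Algebra ℂ H] {K : Hˣ} {x : H} {z : ℂ}
    (hz : z ≠ 0) (h : K * x = z • (x * K)) (j : ℤ) :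
    ∃ w : ℂ, x * ↑(K ^ j) = w • (↑(K ^ j) * x) := by
  have h₁ : x * K = z⁻¹ • (K * x) := mul_eq_inv_smul_of_mul_eq_smul hz h
  have h₂ : x * ↑K⁻¹ = z⁻¹⁻¹ • (↑K⁻¹ * x) :=
    mul_eq_inv_smul_of_mul_eq_smul (inv_ne_zero hz) (Units.inv_mul_eq_smul hz h)
  obtain ⟨n, rfl | rfl⟩ := j.eq_nat_or_neg
  · exact ⟨z⁻¹ ^ n, by simpa using mul_pow_of_mul_eq_smul h₁ n⟩
  · refine ⟨z⁻¹⁻¹ ^ n, ?_⟩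
    have := mul_pow_of_mul_eq_smul h₂ n
    rw [← Units.val_pow_eq_pow_val, inv_pow] at this
    rwa [zpow_neg, zpow_natCast]

theorem IsUqGenerated.span_eq_top {H : Type*} [Ring H] [Algebra ℂ H] {q : ℂ} {E F : H} {K : Hˣ}
    (h : IsUqGenerated q E F K) (hq : q ≠ 0) (hq' : q - q⁻¹ ≠ 0) :
    Submodule.span ℂ (Set.range fun p : ℕ × ℤ × ℕ => F ^ p.1 * ↑(K ^ p.2.1) * E ^ p.2.2) = ⊤ := by
  set v : ℕ × ℤ × ℕ → H := fun p => F ^ p.1 * ↑(K ^ p.2.1) * E ^ p.2.2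
  set M := Submodule.span ℂ (Set.range v)
  have hv : ∀ (i : ℕ) (j : ℤ) (k : ℕ), F ^ i * ↑(K ^ j) * E ^ k ∈ M := fun i j k =>
    Submodule.subset_span ⟨(i, j, k), rfl⟩
  have hF : ∀ m ∈ M, F * m ∈ M := mul_mem_span_of_forall fun p => by
    have : F * v p = F ^ (p.1 + 1) * ↑(K ^ p.2.1) * E ^ p.2.2 := by
      simp only [v, pow_succ', mul_assoc]
    rw [this]
    exact hv _ _ _
  have hKaux : ∀ L : Hˣ, (∃ e : ℤ, L = K ^ e) → (∃ z : ℂ, L * F = z • (F * L)) →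
      ∀ m ∈ M, L * m ∈ M := by
    rintro L ⟨e, rfl⟩ ⟨z, hz⟩
    refine mul_mem_span_of_forall fun p => ?_
    have : ↑(K ^ e) * v p = z ^ p.1 • (F ^ p.1 * ↑(K ^ (e + p.2.1)) * E ^ p.2.2) := by
      simp only [v]
      rw [← mul_assoc, ← mul_assoc, mul_pow_of_mul_eq_smul hz, zpow_add, Units.val_mul]
      simp only [smul_mul_assoc, mul_assoc]
    rw [this]
    exact M.smul_mem _ (hv _ _ _)
  have hK : ∀ m ∈ M, K * m ∈ M := hKaux K ⟨1, by simp⟩ ⟨_, h.K_mul_F⟩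
  have hKinv : ∀ m ∈ M, ↑K⁻¹ * m ∈ M :=
    hKaux K⁻¹ ⟨-1, by simp⟩ ⟨_, Units.inv_mul_eq_smul (inv_ne_zero hq) h.K_mul_F⟩
  have hEF : E * F = F * E + (q - q⁻¹)⁻¹ • ((K * K : H) - ↑K⁻¹ * ↑K⁻¹) := by
    rw [← h.commutator, smul_smul, inv_mul_cancel₀ hq', one_smul]
    abel
  have hE : ∀ m ∈ M, E * m ∈ M := mul_mem_span_of_forall fun p => by
    obtain ⟨i, j, k⟩ := p
    simp only [v]
    induction i with
    | zero =>
      obtain ⟨w, hw⟩ := mul_zpow_of_mul_eq_smul hq h.K_mul_E j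
      have : E * (F ^ 0 * ↑(K ^ j) * E ^ k) = w • (F ^ 0 * ↑(K ^ j) * E ^ (k + 1)) := by
        rw [pow_zero, one_mul, ← mul_assoc, hw, pow_succ', smul_mul_assoc, mul_assoc]
      rw [this]
      exact M.smul_mem _ (hv _ _ _)
    | succ i ih =>
      have : E * (F ^ (i + 1) * ↑(K ^ j) * E ^ k) =
          F * (E * (F ^ i * ↑(K ^ j) * E ^ k)) + (q - q⁻¹)⁻¹ •
            (K * (K * (F ^ i * ↑(K ^ j) * E ^ k)) -
              ↑K⁻¹ * (↑K⁻¹ * (F ^ i * ↑(K ^ j) * E ^ k))) := by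
        rw [pow_succ', mul_assoc F, mul_assoc F, ← mul_assoc E, hEF]
        simp only [add_mul, smul_mul_assoc, sub_mul, mul_assoc]
      rw [this]
      exact M.add_mem (hF _ ih) (M.smul_mem _ (M.sub_mem (hK _ (hK _ (hv _ _ _)))
        (hKinv _ (hKinv _ (hv _ _ _)))))
  refine submodule_eq_top_of_mul_mem h.adjoin_eq_top (by simpa using hv 0 0 0) ?_
  rintro x (rfl | rfl | rfl | rfl)
  exacts [hE, hF, hK, hKinv]

/-- Elements `a`, `b`, `c`, `d` generating an algebra and satisfying the relations of
`SL_q(2,ℂ)`. -/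
structure IsSLqGenerated {A : Type*} [Ring A] [Algebra ℂ A] (q : ℂ) (a b c d : A) : Prop where
  a_mul_b : a * b = q⁻¹ • (b * a)
  a_mul_c : a * c = q⁻¹ • (c * a)
  b_mul_d : b * d = q⁻¹ • (d * b)
  c_mul_d : c * d = q⁻¹ • (d * c)
  b_mul_c : b * c = c * b
  a_mul_d : a * d = 1 + q⁻¹ • (b * c)
  d_mul_a : d * a = 1 + q • (b * c)
  adjoin_eq_top : Algebra.adjoin ℂ {a, b, c, d} = ⊤

/-- The element `a ^ s` for `s ≥ 0` and `d ^ (-s)` for `s < 0`. -/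
def diagPow {A : Type*} [Ring A] (a d : A) : ℤ → A
  | Int.ofNat n => a ^ n
  | Int.negSucc n => d ^ (n + 1)

theorem IsSLqGenerated.span_eq_top {A : Type*} [Ring A] [Algebra ℂ A] {q : ℂ} {a b c d : A}
    (h : IsSLqGenerated q a b c d) (hq : q ≠ 0) :
    Submodule.span ℂ (Set.range fun p : ℕ × ℤ × ℕ =>
      c ^ p.1 * diagPow a d p.2.1 * b ^ p.2.2) = ⊤ := by
  set v : ℕ × ℤ × ℕ → A := fun p => c ^ p.1 * diagPow a d p.2.1 * b ^ p.2.2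
  set M := Submodule.span ℂ (Set.range v)
  have hv : ∀ i j k, c ^ i * diagPow a d j * b ^ k ∈ M := fun i j k =>
    Submodule.subset_span ⟨(i, j, k), rfl⟩
  have hva : ∀ i j k : ℕ, c ^ i * a ^ j * b ^ k ∈ M := fun i j k => hv i (Int.ofNat j) k
  have hvd : ∀ i j k : ℕ, c ^ i * d ^ j * b ^ k ∈ M := fun i j k => by
    cases j with
    | zero => simpa using hva i 0 k
    | succ j => exact hv i (Int.negSucc j) k
  have hc : ∀ m ∈ M, c * m ∈ M := mul_mem_span_of_forall fun p => by
    have : c * v p = c ^ (p.1 + 1) * diagPow a d p.2.1 * b ^ p.2.2 := by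
      simp only [v, pow_succ', mul_assoc]
    rw [this]
    exact hv _ _ _
  have hbg : ∀ s, ∃ z : ℂ, b * diagPow a d s = z • (diagPow a d s * b) := by
    rintro (n | n)
    · exact ⟨_, mul_pow_of_mul_eq_smul
        (mul_eq_inv_smul_of_mul_eq_smul (inv_ne_zero hq) h.a_mul_b) n⟩
    · exact ⟨_, mul_pow_of_mul_eq_smul h.b_mul_d (n + 1)⟩
  have hbc : ∀ n, b * c ^ n = c ^ n * b := fun n =>
    (Commute.pow_right (show Commute b c from h.b_mul_c) n).eq
  have hb : ∀ m ∈ M, b * m ∈ M := mul_mem_span_of_forall fun p => by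
    obtain ⟨z, hz⟩ := hbg p.2.1
    have : b * v p = z • (c ^ p.1 * diagPow a d p.2.1 * b ^ (p.2.2 + 1)) := by
      simp only [v]
      rw [← mul_assoc, ← mul_assoc, hbc, mul_assoc _ b, hz, pow_succ']
      simp only [mul_smul_comm, smul_mul_assoc, mul_assoc]
    rw [this]
    exact M.smul_mem _ (hv _ _ _)
  have hbcM : ∀ i x, c ^ i * (b * c) * x ∈ M ↔ c * (b * (c ^ i * x)) ∈ M := by
    intro i x
    rw [h.b_mul_c, ← mul_assoc (c ^ i), ← pow_succ, pow_succ', mul_assoc c, mul_assoc c,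
      ← hbc, mul_assoc b]
  have ha : ∀ m ∈ M, a * m ∈ M := mul_mem_span_of_forall fun p => by
    obtain ⟨i, s, k⟩ := p
    have h₁ : a * v (i, s, k) = q⁻¹ ^ i • (c ^ i * (a * diagPow a d s) * b ^ k) := by
      simp only [v]
      rw [← mul_assoc, ← mul_assoc, mul_pow_of_mul_eq_smul h.a_mul_c]
      simp only [smul_mul_assoc, mul_assoc]
    rw [h₁]
    refine M.smul_mem _ ?_
    rcases s with n | n
    · simpa only [diagPow, ← pow_succ'] using hva i (n + 1) k
    · have : c ^ i * (a * d ^ (n + 1)) * b ^ k = c ^ i * d ^ n * b ^ k +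
          q⁻¹ • (c ^ i * (b * c) * (d ^ n * b ^ k)) := by
        rw [pow_succ', ← mul_assoc a, h.a_mul_d]
        simp only [add_mul, mul_add, one_mul, smul_mul_assoc, mul_smul_comm, mul_assoc]
      simp only [diagPow]
      rw [this]
      refine M.add_mem (hvd _ _ _) (M.smul_mem _ ((hbcM _ _).mpr (hc _ (hb _ ?_))))
      rw [← mul_assoc]
      exact hvd _ _ _
  have hd : ∀ m ∈ M, d * m ∈ M := mul_mem_span_of_forall fun p => by
    obtain ⟨i, s, k⟩ := p
    have h₁ : d * v (i, s, k) = q⁻¹⁻¹ ^ i • (c ^ i * (d * diagPow a d s) * b ^ k) := by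
      simp only [v]
      rw [← mul_assoc, ← mul_assoc, mul_pow_of_mul_eq_smul
        (mul_eq_inv_smul_of_mul_eq_smul (inv_ne_zero hq) h.c_mul_d)]
      simp only [smul_mul_assoc, mul_assoc]
    rw [h₁]
    refine M.smul_mem _ ?_
    rcases s with n | n
    · cases n with
      | zero => simpa [diagPow] using hvd i 1 k
      | succ n =>
        have : c ^ i * (d * a ^ (n + 1)) * b ^ k = c ^ i * a ^ n * b ^ k +
            q • (c ^ i * (b * c) * (a ^ n * b ^ k)) := by
          rw [pow_succ', ← mul_assoc d, h.d_mul_a]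
          simp only [add_mul, mul_add, one_mul, smul_mul_assoc, mul_smul_comm, mul_assoc]
        simp only [diagPow]
        rw [this]
        refine M.add_mem (hva _ _ _) (M.smul_mem _ ((hbcM _ _).mpr (hc _ (hb _ ?_))))
        rw [← mul_assoc]
        exact hva _ _ _
    · simpa only [diagPow, ← pow_succ'] using hvd i (n + 2) k
  refine submodule_eq_top_of_mul_mem h.adjoin_eq_top (by simpa using hva 0 0 0) ?_
  rintro x (rfl | rfl | rfl | rfl)
  exacts [ha, hb, hc, hd]

/-! ### Twisted derivations -/

/-- The quantum integers appearing in the twisted Leibniz rule. -/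
def twistedInt (z : ℂ) : ℕ → ℂ
  | 0 => 0
  | n + 1 => z⁻¹ ^ n + z ^ 3 * twistedInt z n

theorem twistedInt_mul (z : ℂ) (hz : z ≠ 0) (n : ℕ) :
    twistedInt z n * (z ^ 4 - 1) = z * ((z ^ 3) ^ n - z⁻¹ ^ n) := by
  induction n with
  | zero => simp [twistedInt]
  | succ n ih =>
    rw [twistedInt, add_mul, mul_assoc, ih, pow_succ, pow_succ z⁻¹]
    field_simp
    ring

theorem twistedInt_ne_zero {z : ℂ} (hz : z ≠ 0) (hroot : ∀ n : ℕ, n ≠ 0 → (z ^ 2) ^ n ≠ 1)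
    {n : ℕ} (hn : n ≠ 0) : twistedInt z n ≠ 0 := by
  intro h
  have h' := twistedInt_mul z hz n
  rw [h, zero_mul, eq_comm, mul_eq_zero, or_iff_right hz, sub_eq_zero, inv_pow] at h'
  refine hroot (2 * n) (by omega) ?_
  rw [← inv_mul_cancel₀ (pow_ne_zero n hz), ← h']
  ring

section TwistedDerivation

variable {A : Type*} [Ring A] [Algebra ℂ A]

/-- `N` is a twisted derivation with respect to the algebra endomorphisms `T` and `T'`. -/
structure IsTwistedDerivation (N T T' : A →ₗ[ℂ] A) : Prop where
  map_mul : ∀ f g, N (f * g) = N f * T g + T' f * N g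
  map_one : N 1 = 0
  left_mul : ∀ f g, T (f * g) = T f * T g
  left_one : T 1 = 1
  right_mul : ∀ f g, T' (f * g) = T' f * T' g
  right_one : T' 1 = 1

theorem map_pow_of_map_eq_smul {T : A →ₗ[ℂ] A} (hT : ∀ f g, T (f * g) = T f * T g) (h1 : T 1 = 1)
    {f : A} {z : ℂ} (hf : T f = z • f) (n : ℕ) : T (f ^ n) = z ^ n • f ^ n := by
  induction n with
  | zero => simp [h1]
  | succ n ih => rw [pow_succ, hT, ih, hf, smul_mul_smul_comm, ← pow_succ, ← pow_succ]

theorem iterate_mul_of_map_eq_smul {T : A →ₗ[ℂ] A} (hT : ∀ f g, T (f * g) = T f * T g)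
    {f : A} {z : ℂ} (hf : T f = z • f) (n : ℕ) (g : A) :
    (T ^ n) (f * g) = z ^ n • (f * (T ^ n) g) := by
  induction n generalizing g with
  | zero => simp
  | succ n ih =>
    rw [pow_succ, Module.End.mul_apply, hT, hf, smul_mul_assoc, map_smul, ih, smul_smul,
      Module.End.mul_apply, ← pow_succ']

theorem map_diagPow_of_map_eq_smul {T : A →ₗ[ℂ] A} (hT : ∀ f g, T (f * g) = T f * T g)
    (h1 : T 1 = 1) {a d : A} {z : ℂ} (ha : T a = z • a) (hd : T d = z⁻¹ • d) (s : ℤ) :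
    T (diagPow a d s) = z ^ s • diagPow a d s := by
  cases s with
  | ofNat n => simpa [diagPow] using map_pow_of_map_eq_smul hT h1 ha n
  | negSucc n => simpa [diagPow] using map_pow_of_map_eq_smul hT h1 hd (n + 1)

theorem iterate_of_map_eq_smul {T : A →ₗ[ℂ] A} {f : A} {z : ℂ} (hf : T f = z • f) (n : ℕ) :
    (T ^ n) f = z ^ n • f := by
  induction n with
  | zero => simp
  | succ n ih => rw [pow_succ, Module.End.mul_apply, hf, map_smul, ih, smul_smul, pow_succ']

namespace IsTwistedDerivation

variable {N T T' : A →ₗ[ℂ] A} {l ν : ℂ} {a b c : A}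

/-- Applying `N` up to `r` times to `c ^ r * g`, modulo the ideal generated by `c`. -/
theorem iterate_pow_mul (h : IsTwistedDerivation N T T') (hl : l ≠ 0)
    (hroot : ∀ n : ℕ, n ≠ 0 → (l ^ 2) ^ n ≠ 1) (hν : ν ≠ 0)
    (hac : a * c = (l ^ 2)⁻¹ • (c * a)) (hnormal : ∀ f, ∃ f', f * c = c * f')
    (hNc : N c = ν • a) (hTa : T a = l • a) (hTc : T c = l⁻¹ • c) (hTc' : T' c = l • c) (r : ℕ) :
    ∃ C : ℂ, C ≠ 0 ∧ ∀ i ≤ r, ∀ g, ∃ f,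
      (N ^ i) (c ^ r * g) = (if i = r then C • (a ^ r * (T ^ r) g) else 0) + c * f := by
  have hpow : ∀ n, N (c ^ (n + 1)) = (ν * twistedInt l⁻¹ (n + 1)) • (c ^ n * a) := by
    intro n
    induction n with
    | zero => simp [hNc, twistedInt]
    | succ n ih =>
      rw [pow_succ, h.map_mul, ih, hTc, hNc, map_pow_of_map_eq_smul h.right_mul h.right_one hTc',
        smul_mul_smul_comm, smul_mul_smul_comm, mul_assoc (c ^ n) a c, hac, mul_smul_comm,
        smul_smul, ← mul_assoc (c ^ n) c a, ← pow_succ, ← add_smul, twistedInt.eq_2 _ (n + 1),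
        inv_inv]
      congr 1
      field_simp
      ring
  have hroot' : ∀ n : ℕ, n ≠ 0 → (l⁻¹ ^ 2) ^ n ≠ 1 := by
    intro n hn
    rw [inv_pow, inv_pow, ne_eq, inv_eq_one]
    exact hroot n hn
  induction r with
  | zero =>
    refine ⟨1, one_ne_zero, fun i hi g => ⟨0, ?_⟩⟩
    obtain rfl : i = 0 := by omega
    simp
  | succ r ih =>
    obtain ⟨C, hC, hiter⟩ := ih
    refine ⟨ν * twistedInt l⁻¹ (r + 1) * (C * l ^ r),
      mul_ne_zero (mul_ne_zero hν (twistedInt_ne_zero (inv_ne_zero hl) hroot' r.succ_ne_zero))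
        (mul_ne_zero hC (pow_ne_zero r hl)), ?_⟩
    intro i hi g
    cases i with
    | zero => exact ⟨c ^ r * g, by simp [pow_succ', mul_assoc]⟩
    | succ i =>
      have hi' : i ≤ r := by omega
      obtain ⟨f₁, hf₁⟩ := hiter i hi' (a * T g)
      obtain ⟨f₂, hf₂⟩ := hiter i hi' (c * N g)
      obtain ⟨f₃, hf₃⟩ := hnormal (a ^ r)
      have hstep : N (c ^ (r + 1) * g) =
          (ν * twistedInt l⁻¹ (r + 1)) • (c ^ r * (a * T g)) +
            l ^ (r + 1) • (c ^ r * (c * N g)) := by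
        rw [h.map_mul, hpow, map_pow_of_map_eq_smul h.right_mul h.right_one hTc', smul_mul_assoc,
          smul_mul_assoc, mul_assoc, pow_succ c, mul_assoc (c ^ r) c]
      rw [pow_succ, Module.End.mul_apply, hstep, map_add, map_smul, map_smul, hf₁, hf₂,
        iterate_mul_of_map_eq_smul h.left_mul hTa, iterate_mul_of_map_eq_smul h.left_mul hTc,
        pow_succ T, Module.End.mul_apply]
      by_cases hir : i = r
      · subst hir
        refine ⟨(ν * twistedInt l⁻¹ (i + 1)) • f₁ + l ^ (i + 1) •
          ((C * l⁻¹ ^ i) • (f₃ * (T ^ i) (N g)) + f₂), ?_⟩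
        simp only [if_true, mul_smul_comm, ← mul_assoc, hf₃, mul_add, smul_add, smul_smul,
          pow_succ]
        abel
      · refine ⟨(ν * twistedInt l⁻¹ (r + 1)) • f₁ + l ^ (r + 1) • f₂, ?_⟩
        have : ¬ i + 1 = r + 1 := by omega
        simp [hir, mul_add]

theorem iterate_left_ideal (h : IsTwistedDerivation N T T') (hNc : N c = 0) {z : ℂ}
    (hTc' : T' c = z • c) (k : ℕ) (f : A) : ∃ f', (N ^ k) (c * f) = c * f' := by
  induction k generalizing f with
  | zero => exact ⟨f, rfl⟩
  | succ k ih =>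
    obtain ⟨f', hf⟩ := ih (z • N f)
    refine ⟨f', ?_⟩
    rw [pow_succ, Module.End.mul_apply, h.map_mul, hNc, hTc', zero_mul, zero_add,
      smul_mul_assoc, ← mul_smul_comm, hf]

/-- The elements sent by `N` into a normal ideal `c * A` are closed under products. -/
theorem map_mul_mem_ideal (h : IsTwistedDerivation N T T') (hnormal : ∀ f, ∃ f', f * c = c * f')
    {f g : A} (hf : ∃ f', N f = c * f') (hg : ∃ g', N g = c * g') : ∃ f', N (f * g) = c * f' := by
  obtain ⟨f', hf⟩ := hf
  obtain ⟨g', hg⟩ := hg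
  obtain ⟨f'', hf''⟩ := hnormal (T' f)
  refine ⟨f' * T g + f'' * g', ?_⟩
  rw [h.map_mul, hf, hg, ← mul_assoc, hf'', mul_add, mul_assoc, mul_assoc]

theorem map_pow_mem_ideal (h : IsTwistedDerivation N T T') (hnormal : ∀ f, ∃ f', f * c = c * f')
    {f : A} (hf : ∃ f', N f = c * f') (n : ℕ) : ∃ f', N (f ^ n) = c * f' := by
  induction n with
  | zero => exact ⟨0, by simp [h.map_one]⟩
  | succ n ih => exact pow_succ f n ▸ h.map_mul_mem_ideal hnormal ih hf

/-- Applying `N` to `g * b ^ t`, modulo `c * A + A * b`. -/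
theorem iterate_mul_pow (h : IsTwistedDerivation N T T') (hl : l ≠ 0)
    (hroot : ∀ n : ℕ, n ≠ 0 → (l ^ 2) ^ n ≠ 1) (hν : ν ≠ 0)
    (hba : b * a = l ^ 2 • (a * b)) (hNa : N a = 0) (hNb : N b = ν • a) (hNc : N c = 0)
    (hTb : T b = l⁻¹ • b) (hTb' : T' b = l • b) (hTa' : T' a = l⁻¹ • a) (hTc' : T' c = l⁻¹ • c)
    (t : ℕ) (g : A) (w : ℂ) (hw : w ≠ 0) (hg : T' g = w • g) (hNg : ∃ f, N g = c * f) :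
    ∃ C : ℂ, C ≠ 0 ∧ ∀ k, ∃ f f',
      (N ^ k) (g * b ^ t) = (if k = t then C • (g * a ^ t) else 0) + c * f + f' * b := by
  have hpow : ∀ n, N (b ^ (n + 1)) = (ν * twistedInt l (n + 1)) • (a * b ^ n) := by
    intro n
    induction n with
    | zero => simp [hNb, twistedInt]
    | succ n ih =>
      rw [pow_succ', h.map_mul, ih, hTb', hNb, map_pow_of_map_eq_smul h.left_mul h.left_one hTb,
        smul_mul_smul_comm, smul_mul_smul_comm, ← mul_assoc b a, hba, smul_mul_assoc, smul_smul,
        mul_assoc a b, ← pow_succ', ← add_smul, twistedInt.eq_2 _ (n + 1)]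
      congr 1
      ring
  have hideal := h.iterate_left_ideal hNc hTc'
  induction t generalizing g w with
  | zero =>
    refine ⟨1, one_ne_zero, fun k => ?_⟩
    cases k with
    | zero => exact ⟨0, 0, by simp⟩
    | succ k =>
      obtain ⟨f, hf⟩ := hNg
      obtain ⟨f', hf'⟩ := hideal k f
      exact ⟨f', 0, by simp [pow_succ, hf, hf']⟩
  | succ t ih =>
    obtain ⟨f, hf⟩ := hNg
    obtain ⟨C, hC, hiter⟩ := ih (g * a) (w * l⁻¹) (mul_ne_zero hw (inv_ne_zero hl))
      (by rw [h.right_mul, hg, hTa', smul_mul_smul_comm])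
      ⟨f * T a, by rw [h.map_mul, hf, hNa, mul_zero, add_zero, mul_assoc]⟩
    refine ⟨w * (ν * twistedInt l (t + 1)) * C,
      mul_ne_zero (mul_ne_zero hw (mul_ne_zero hν (twistedInt_ne_zero hl hroot t.succ_ne_zero)))
        hC, fun k => ?_⟩
    cases k with
    | zero => exact ⟨0, g * b ^ t, by simp [pow_succ, mul_assoc]⟩
    | succ k =>
      obtain ⟨f₁, f₂, hk⟩ := hiter k
      have hstep : N (g * b ^ (t + 1)) = c * (f * T (b ^ (t + 1))) +
          (w * (ν * twistedInt l (t + 1))) • (g * a * b ^ t) := by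
        rw [h.map_mul, hpow, hf, hg, smul_mul_smul_comm, mul_assoc, mul_assoc g]
      obtain ⟨f₃, hf₃⟩ := hideal k (f * T (b ^ (t + 1)))
      refine ⟨f₃ + (w * (ν * twistedInt l (t + 1))) • f₁,
        (w * (ν * twistedInt l (t + 1))) • f₂, ?_⟩
      rw [pow_succ, Module.End.mul_apply, hstep, map_add, map_smul, hk, hf₃]
      by_cases hkt : k = t
      · subst hkt
        simp only [if_true, mul_add, smul_add, smul_smul, mul_smul_comm, smul_mul_assoc,
          mul_assoc, pow_succ']
        abel
      · have : ¬ k + 1 = t + 1 := by omega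
        simp only [hkt, this, if_false, zero_add, mul_add, smul_add, mul_smul_comm,
          smul_mul_assoc, add_assoc]

end IsTwistedDerivation

end TwistedDerivation

/-! ### The regular actions -/

section Actions

variable {H A : Type*} [Ring H] [Algebra ℂ H] [Ring A] [Algebra ℂ A]

/-- The action `f ↦ Σ f₍₁₎ ⟨x, f₍₂₎⟩`. -/
def leftAct (B : H →ₗ[ℂ] Module.Dual ℂ A) (ΔA : A →ₐ[ℂ] (A ⊗[ℂ] A)) (x : H) : A →ₗ[ℂ] A :=
  (TensorProduct.rid ℂ A).toLinearMap ∘ₗ (B x).lTensor A ∘ₗ ΔA.toLinearMap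

/-- The action `f ↦ Σ ⟨x, f₍₁₎⟩ f₍₂₎`. -/
def rightAct (B : H →ₗ[ℂ] Module.Dual ℂ A) (ΔA : A →ₐ[ℂ] (A ⊗[ℂ] A)) (x : H) : A →ₗ[ℂ] A :=
  (TensorProduct.lid ℂ A).toLinearMap ∘ₗ (B x).rTensor A ∘ₗ ΔA.toLinearMap

variable {B : H →ₗ[ℂ] Module.Dual ℂ A} {ΔA : A →ₐ[ℂ] (A ⊗[ℂ] A)}

theorem pairing_mul_eq_leftAct (h : ∀ x y f, B (x * y) f = pair2 B (x ⊗ₜ[ℂ] y) (ΔA f))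
    (y x : H) (f : A) : B (y * x) f = B y (leftAct B ΔA x f) := by
  rw [h]
  simp only [leftAct, LinearMap.comp_apply, AlgHom.toLinearMap_apply, LinearEquiv.coe_coe]
  induction ΔA f using TensorProduct.induction_on with
  | zero => simp
  | tmul u v => simp [mul_comm]
  | add s t hs ht => simp only [map_add, hs, ht]

theorem pairing_mul_eq_rightAct (h : ∀ x y f, B (x * y) f = pair2 B (x ⊗ₜ[ℂ] y) (ΔA f))
    (x y : H) (f : A) : B (x * y) f = B y (rightAct B ΔA x f) := by
  rw [h]
  simp only [rightAct, LinearMap.comp_apply, AlgHom.toLinearMap_apply, LinearEquiv.coe_coe]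
  induction ΔA f using TensorProduct.induction_on with
  | zero => simp
  | tmul u v => simp
  | add s t hs ht => simp only [map_add, hs, ht]

theorem pairing_mul_pow_eq_leftAct (h : ∀ x y f, B (x * y) f = pair2 B (x ⊗ₜ[ℂ] y) (ΔA f))
    (y x : H) (k : ℕ) (f : A) : B (y * x ^ k) f = B y ((leftAct B ΔA x ^ k) f) := by
  induction k generalizing f with
  | zero => simp
  | succ k ih =>
    rw [pow_succ, ← mul_assoc, pairing_mul_eq_leftAct h, ih, pow_succ, Module.End.mul_apply]

theorem pairing_pow_mul_eq_rightAct (h : ∀ x y f, B (x * y) f = pair2 B (x ⊗ₜ[ℂ] y) (ΔA f))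
    (x y : H) (k : ℕ) (f : A) : B (x ^ k * y) f = B y ((rightAct B ΔA x ^ k) f) := by
  induction k generalizing f with
  | zero => simp
  | succ k ih =>
    rw [pow_succ', mul_assoc, pairing_mul_eq_rightAct h, ih, pow_succ, Module.End.mul_apply]

theorem leftAct_mul_of_pairing {x x₁ x₂ x₃ x₄ : H}
    (hx : ∀ f g, B x (f * g) = B x₁ f * B x₂ g + B x₃ f * B x₄ g) (f g : A) :
    leftAct B ΔA x (f * g) = leftAct B ΔA x₁ f * leftAct B ΔA x₂ g +
      leftAct B ΔA x₃ f * leftAct B ΔA x₄ g := by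
  simp only [leftAct, LinearMap.comp_apply, AlgHom.toLinearMap_apply, LinearEquiv.coe_coe, map_mul]
  induction ΔA f using TensorProduct.induction_on with
  | zero => simp
  | add s t hs ht =>
    simp only [map_add, add_mul, hs, ht]
    abel
  | tmul u v =>
    induction ΔA g using TensorProduct.induction_on with
    | zero => simp
    | add s t hs ht =>
      simp only [map_add, mul_add, hs, ht]
      abel
    | tmul u' v' =>
      simp [hx, add_smul, smul_smul, mul_comm]

theorem rightAct_mul_of_pairing {x x₁ x₂ x₃ x₄ : H}
    (hx : ∀ f g, B x (f * g) = B x₁ f * B x₂ g + B x₃ f * B x₄ g) (f g : A) :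
    rightAct B ΔA x (f * g) = rightAct B ΔA x₁ f * rightAct B ΔA x₂ g +
      rightAct B ΔA x₃ f * rightAct B ΔA x₄ g := by
  simp only [rightAct, LinearMap.comp_apply, AlgHom.toLinearMap_apply, LinearEquiv.coe_coe, map_mul]
  induction ΔA f using TensorProduct.induction_on with
  | zero => simp
  | add s t hs ht =>
    simp only [map_add, add_mul, hs, ht]
    abel
  | tmul u v =>
    induction ΔA g using TensorProduct.induction_on with
    | zero => simp
    | add s t hs ht =>
      simp only [map_add, mul_add, hs, ht]
      abel
    | tmul u' v' =>
      simp [hx, add_smul, smul_smul, mul_comm]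

/-- An element of `H` acting as a character of `A`. -/
structure IsCharacter (B : H →ₗ[ℂ] Module.Dual ℂ A) (x : H) : Prop where
  map_mul : ∀ f g, B x (f * g) = B x f * B x g
  map_one : B x 1 = 1

theorem IsCharacter.leftAct_mul {x : H} (hx : IsCharacter B x) (f g : A) :
    leftAct B ΔA x (f * g) = leftAct B ΔA x f * leftAct B ΔA x g := by
  have := leftAct_mul_of_pairing (B := B) (ΔA := ΔA) (x := x) (x₁ := x) (x₂ := x) (x₃ := 0)
    (x₄ := 0) (by simp [hx.map_mul]) f g
  simpa [leftAct] using this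

theorem IsCharacter.rightAct_mul {x : H} (hx : IsCharacter B x) (f g : A) :
    rightAct B ΔA x (f * g) = rightAct B ΔA x f * rightAct B ΔA x g := by
  have := rightAct_mul_of_pairing (B := B) (ΔA := ΔA) (x := x) (x₁ := x) (x₂ := x) (x₃ := 0)
    (x₄ := 0) (by simp [hx.map_mul]) f g
  simpa [rightAct] using this

theorem leftAct_one (x : H) : leftAct B ΔA x 1 = B x 1 • (1 : A) := by
  simp [leftAct, Algebra.TensorProduct.one_def]

theorem rightAct_one (x : H) : rightAct B ΔA x 1 = B x 1 • (1 : A) := by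
  simp [rightAct, Algebra.TensorProduct.one_def]

theorem IsCharacter.mul (h : ∀ x y f, B (x * y) f = pair2 B (x ⊗ₜ[ℂ] y) (ΔA f)) {x y : H}
    (hx : IsCharacter B x) (hy : IsCharacter B y) : IsCharacter B (x * y) where
  map_mul f g := by
    simp only [pairing_mul_eq_leftAct h, hy.leftAct_mul, hx.map_mul]
  map_one := by
    rw [pairing_mul_eq_leftAct h, leftAct_one, hy.map_one, one_smul, hx.map_one]

theorem IsCharacter.map_pow {x : H} (hx : IsCharacter B x) (f : A) (n : ℕ) :
    B x (f ^ n) = B x f ^ n := by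
  induction n with
  | zero => simp [hx.map_one]
  | succ n ih => rw [pow_succ, hx.map_mul, ih, pow_succ]

theorem IsCharacter.map_diagPow {x : H} (hx : IsCharacter B x) {a d : A} {z : ℂ}
    (ha : B x a = z) (hd : B x d = z⁻¹) (s : ℤ) : B x (diagPow a d s) = z ^ s := by
  cases s with
  | ofNat n => simp [diagPow, hx.map_pow, ha]
  | negSucc n => simp [diagPow, hx.map_pow, hd]

end Actions

/-! ### The pairing on monomials -/

/-- The standard pairing, expressed through its generators `E`, `F`, `K` and `a`, `b`, `c`, `d`. -/
structure IsStandardPairing {H A : Type*} [Ring H] [Algebra ℂ H] [Ring A] [Algebra ℂ A] (l μ : ℂ)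
    (B : H →ₗ[ℂ] Module.Dual ℂ A) (ΔA : A →ₐ[ℂ] (A ⊗[ℂ] A)) (E F : H) (K : Hˣ) (a b c d : A) :
    Prop where
  mul_left : ∀ x y f, B (x * y) f = pair2 B (x ⊗ₜ[ℂ] y) (ΔA f)
  character_one : IsCharacter B 1
  character_K : IsCharacter B K
  character_Kinv : IsCharacter B ↑K⁻¹
  E_mul : ∀ f g, B E (f * g) = B E f * B K g + B ↑K⁻¹ f * B E g
  F_mul : ∀ f g, B F (f * g) = B F f * B K g + B ↑K⁻¹ f * B F g
  E_one : B E 1 = 0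
  F_one : B F 1 = 0
  comul_a : ΔA a = a ⊗ₜ[ℂ] a + b ⊗ₜ[ℂ] c
  comul_b : ΔA b = a ⊗ₜ[ℂ] b + b ⊗ₜ[ℂ] d
  comul_c : ΔA c = c ⊗ₜ[ℂ] a + d ⊗ₜ[ℂ] c
  comul_d : ΔA d = c ⊗ₜ[ℂ] b + d ⊗ₜ[ℂ] d
  one_gen : B 1 a = 1 ∧ B 1 b = 0 ∧ B 1 c = 0 ∧ B 1 d = 1
  E_gen : B E a = 0 ∧ B E b = μ ∧ B E c = 0 ∧ B E d = 0
  F_gen : B F a = 0 ∧ B F b = 0 ∧ B F c = μ⁻¹ ∧ B F d = 0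
  K_gen : B K a = l ∧ B K b = 0 ∧ B K c = 0 ∧ B K d = l⁻¹
  Kinv_gen : B ↑K⁻¹ a = l⁻¹ ∧ B ↑K⁻¹ b = 0 ∧ B ↑K⁻¹ c = 0 ∧ B ↑K⁻¹ d = l

namespace IsStandardPairing

variable {H A : Type*} [Ring H] [Algebra ℂ H] [Ring A] [Algebra ℂ A] {l μ : ℂ}
  {B : H →ₗ[ℂ] Module.Dual ℂ A} {ΔA : A →ₐ[ℂ] (A ⊗[ℂ] A)} {E F : H} {K : Hˣ} {a b c d : A}

theorem leftAct_gen (h : IsStandardPairing l μ B ΔA E F K a b c d) (x : H) :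
    leftAct B ΔA x a = B x a • a + B x c • b ∧ leftAct B ΔA x b = B x b • a + B x d • b ∧
      leftAct B ΔA x c = B x a • c + B x c • d ∧ leftAct B ΔA x d = B x b • c + B x d • d := by
  simp [leftAct, h.comul_a, h.comul_b, h.comul_c, h.comul_d]

theorem rightAct_gen (h : IsStandardPairing l μ B ΔA E F K a b c d) (x : H) :
    rightAct B ΔA x a = B x a • a + B x b • c ∧ rightAct B ΔA x b = B x a • b + B x b • d ∧
      rightAct B ΔA x c = B x c • a + B x d • c ∧ rightAct B ΔA x d = B x c • b + B x d • d := by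
  simp [rightAct, h.comul_a, h.comul_b, h.comul_c, h.comul_d]

theorem isTwistedDerivation_left (h : IsStandardPairing l μ B ΔA E F K a b c d) :
    IsTwistedDerivation (leftAct B ΔA E) (leftAct B ΔA K) (leftAct B ΔA ↑K⁻¹) where
  map_mul := leftAct_mul_of_pairing h.E_mul
  map_one := by rw [leftAct_one, h.E_one, zero_smul]
  left_mul := h.character_K.leftAct_mul
  left_one := by rw [leftAct_one, h.character_K.map_one, one_smul]
  right_mul := h.character_Kinv.leftAct_mul
  right_one := by rw [leftAct_one, h.character_Kinv.map_one, one_smul]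

theorem isTwistedDerivation_right (h : IsStandardPairing l μ B ΔA E F K a b c d) :
    IsTwistedDerivation (rightAct B ΔA F) (rightAct B ΔA K) (rightAct B ΔA ↑K⁻¹) where
  map_mul := rightAct_mul_of_pairing h.F_mul
  map_one := by rw [rightAct_one, h.F_one, zero_smul]
  left_mul := h.character_K.rightAct_mul
  left_one := by rw [rightAct_one, h.character_K.map_one, one_smul]
  right_mul := h.character_Kinv.rightAct_mul
  right_one := by rw [rightAct_one, h.character_Kinv.map_one, one_smul]

theorem zpow_K (h : IsStandardPairing l μ B ΔA E F K a b c d) (hl : l ≠ 0) (j : ℤ) :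
    IsCharacter B ↑(K ^ j) ∧ B ↑(K ^ j) a = l ^ j ∧ B ↑(K ^ j) b = 0 ∧ B ↑(K ^ j) c = 0 ∧
      B ↑(K ^ j) d = (l ^ j)⁻¹ := by
  obtain ⟨ea, eb, ec, ed⟩ := h.one_gen
  obtain ⟨ka, kb, kc, kd⟩ := h.K_gen
  obtain ⟨ia, ib, ic, id⟩ := h.Kinv_gen
  obtain ⟨La, Lb, Lc, Ld⟩ := h.leftAct_gen K
  obtain ⟨Ma, Mb, Mc, Md⟩ := h.leftAct_gen ↑K⁻¹
  induction j using Int.induction_on with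
  | zero => simp [h.character_one, ea, eb, ec, ed]
  | succ n ih =>
    obtain ⟨hch, ha, hb, hc, hd⟩ := ih
    rw [zpow_add_one, zpow_add_one₀ hl, Units.val_mul]
    refine ⟨hch.mul h.mul_left h.character_K, ?_⟩
    simp only [pairing_mul_eq_leftAct h.mul_left, La, Lb, Lc, Ld, ka, kb, kc, kd, map_add,
      map_smul, ha, hb, hc, hd, smul_eq_mul, mul_zero, add_zero, zero_add, mul_inv,
      mul_comm, and_self]
  | pred n ih =>
    obtain ⟨hch, ha, hb, hc, hd⟩ := ih
    rw [zpow_sub_one, zpow_sub_one₀ hl, Units.val_mul]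
    refine ⟨hch.mul h.mul_left h.character_Kinv, ?_⟩
    simp only [pairing_mul_eq_leftAct h.mul_left, Ma, Mb, Mc, Md, ia, ib, ic, id, map_add,
      map_smul, ha, hb, hc, hd, smul_eq_mul, mul_zero, add_zero, zero_add, mul_inv,
      mul_comm, inv_inv, and_self]

end IsStandardPairing

theorem IsSLqGenerated.exists_mul_eq {A : Type*} [Ring A] [Algebra ℂ A] {q : ℂ} {a b c d : A}
    (h : IsSLqGenerated q a b c d) (hq : q ≠ 0) (f : A) : ∃ f', f * c = c * f' := by
  have hf : f ∈ Algebra.adjoin ℂ {a, b, c, d} := h.adjoin_eq_top ▸ Algebra.mem_top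
  induction hf using Algebra.adjoin_induction with
  | mem x hx =>
    rcases hx with rfl | rfl | rfl | rfl
    · exact ⟨q⁻¹ • x, by rw [h.a_mul_c, mul_smul_comm]⟩
    · exact ⟨x, h.b_mul_c⟩
    · exact ⟨x, rfl⟩
    · exact ⟨q • x, by rw [mul_smul_comm, h.c_mul_d, smul_smul, mul_inv_cancel₀ hq, one_smul]⟩
  | algebraMap r => exact ⟨algebraMap ℂ A r, Algebra.commutes r c⟩
  | add x y _ _ hx hy =>
    obtain ⟨x', hx⟩ := hx
    obtain ⟨y', hy⟩ := hy
    exact ⟨x' + y', by rw [add_mul, mul_add, hx, hy]⟩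
  | mul x y _ _ hx hy =>
    obtain ⟨x', hx⟩ := hx
    obtain ⟨y', hy⟩ := hy
    exact ⟨x' * y', by rw [mul_assoc, hy, ← mul_assoc, hx, mul_assoc]⟩

/-- The pairing is triangular on monomials. -/
theorem IsStandardPairing.exists_monomial_eq {H A : Type*} [Ring H] [Algebra ℂ H] [Ring A]
    [Algebra ℂ A] {l μ : ℂ} {B : H →ₗ[ℂ] Module.Dual ℂ A} {ΔA : A →ₐ[ℂ] (A ⊗[ℂ] A)} {E F : H}
    {K : Hˣ} {a b c d : A} (h : IsStandardPairing l μ B ΔA E F K a b c d)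
    (hA : IsSLqGenerated (l ^ 2) a b c d) (hl : l ≠ 0) (hμ : μ ≠ 0)
    (hroot : ∀ n : ℕ, n ≠ 0 → (l ^ 2) ^ n ≠ 1) (r : ℕ) (s : ℤ) (t : ℕ) :
    ∃ C : ℂ, C ≠ 0 ∧ ∀ i ≤ r, ∀ (j : ℤ) (k : ℕ),
      B (F ^ i * ↑(K ^ j) * E ^ k) (c ^ r * diagPow a d s * b ^ t) =
        if i = r ∧ k = t then C * (l ^ j) ^ (r + s + t) else 0 := by
  have hq : l ^ 2 ≠ 0 := pow_ne_zero 2 hl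
  have hnormal := hA.exists_mul_eq hq
  have hL := h.isTwistedDerivation_left
  have hR := h.isTwistedDerivation_right
  obtain ⟨Ea, Eb, Ec, Ed⟩ := h.E_gen
  obtain ⟨-, -, Fc, Fd⟩ := h.F_gen
  obtain ⟨Ka, Kb, Kc, Kd⟩ := h.K_gen
  obtain ⟨Ia, Ib, Ic, Id⟩ := h.Kinv_gen
  obtain ⟨LEa, LEb, LEc, LEd⟩ := h.leftAct_gen E
  obtain ⟨-, LKb, -, -⟩ := h.leftAct_gen K
  obtain ⟨LIa, LIb, LIc, LId⟩ := h.leftAct_gen ↑K⁻¹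
  obtain ⟨-, -, RFc, -⟩ := h.rightAct_gen F
  obtain ⟨RKa, RKb, RKc, RKd⟩ := h.rightAct_gen K
  obtain ⟨-, -, RIc, -⟩ := h.rightAct_gen ↑K⁻¹
  simp only [Ea, Eb, Ec, Ed, Fc, Fd, Ka, Kb, Kc, Kd, Ia, Ib, Ic, Id, zero_smul, add_zero,
    zero_add] at LEa LEb LEc LEd LKb LIa LIb LIc LId RFc RKa RKb RKc RKd RIc
  obtain ⟨C₁, hC₁, hC₁'⟩ := hR.iterate_pow_mul hl hroot (inv_ne_zero hμ) hA.a_mul_c hnormal RFc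
    RKa RKc RIc r
  have hdiag : leftAct B ΔA ↑K⁻¹ (a ^ r * diagPow a d s) =
      (l⁻¹ ^ r * l⁻¹ ^ s) • (a ^ r * diagPow a d s) := by
    rw [hL.right_mul, map_pow_of_map_eq_smul hL.right_mul hL.right_one LIa,
      map_diagPow_of_map_eq_smul hL.right_mul hL.right_one LIa (by rwa [inv_inv]),
      smul_mul_smul_comm]
  have hE : ∃ f, leftAct B ΔA E (a ^ r * diagPow a d s) = c * f := by
    have ha : ∃ f, leftAct B ΔA E a = c * f := ⟨0, by rw [LEa, mul_zero]⟩
    have hd : ∃ f, leftAct B ΔA E d = c * f := ⟨μ • 1, by rw [LEd, mul_smul_comm, mul_one]⟩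
    refine hL.map_mul_mem_ideal hnormal (hL.map_pow_mem_ideal hnormal ha r) ?_
    cases s with
    | ofNat n => exact hL.map_pow_mem_ideal hnormal ha n
    | negSucc n => exact hL.map_pow_mem_ideal hnormal hd (n + 1)
  obtain ⟨C₂, hC₂, hC₂'⟩ := hL.iterate_mul_pow hl hroot hμ
    (mul_eq_inv_smul_of_mul_eq_smul (inv_ne_zero hq) hA.a_mul_b |>.trans (by rw [inv_inv])) LEa LEb
    LEc LKb LIb LIa LIc t _ _
    (mul_ne_zero (pow_ne_zero r (inv_ne_zero hl)) (zpow_ne_zero s (inv_ne_zero hl))) hdiag hE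
  have hK : rightAct B ΔA K (diagPow a d s * b ^ t) =
      (l ^ s * l ^ t) • (diagPow a d s * b ^ t) := by
    rw [hR.left_mul, map_pow_of_map_eq_smul hR.left_mul hR.left_one RKb,
      map_diagPow_of_map_eq_smul hR.left_mul hR.left_one RKa RKd, smul_mul_smul_comm]
  refine ⟨C₁ * (l ^ s * l ^ t) ^ r * C₂, mul_ne_zero (mul_ne_zero hC₁ (pow_ne_zero r
    (mul_ne_zero (zpow_ne_zero s hl) (pow_ne_zero t hl)))) hC₂, fun i hi j k => ?_⟩
  obtain ⟨hch, ha, hb, hc, hd⟩ := h.zpow_K hl j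
  obtain ⟨f, hf⟩ := hC₁' i hi (diagPow a d s * b ^ t)
  obtain ⟨f', hf'⟩ := hL.iterate_left_ideal LEc LIc k f
  rw [mul_assoc, mul_assoc, pairing_pow_mul_eq_rightAct h.mul_left, hf,
    pairing_mul_pow_eq_leftAct h.mul_left, map_add, hf', map_add, hch.map_mul, hc, zero_mul,
    add_zero]
  by_cases hir : i = r
  · obtain ⟨f₁, f₂, hf₁₂⟩ := hC₂' k
    rw [if_pos hir, iterate_of_map_eq_smul hK, mul_smul_comm, smul_smul, ← mul_assoc, map_smul,
      hf₁₂, map_smul, map_add, map_add, hch.map_mul c, hch.map_mul f₂, hb, hc, zero_mul, mul_zero,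
      add_zero, add_zero]
    by_cases hkt : k = t
    · have hz : l ^ j ≠ 0 := zpow_ne_zero j hl
      rw [if_pos hkt, if_pos ⟨hir, hkt⟩, map_smul, hch.map_mul, hch.map_mul, hch.map_pow,
        hch.map_pow, hch.map_diagPow ha hd, ha, zpow_add₀ hz, zpow_add₀ hz, zpow_natCast,
        zpow_natCast, smul_eq_mul, smul_eq_mul]
      ring
    · simp [hkt]
  · simp [hir]

/-! ### Nondegeneracy -/

theorem eq_zero_of_forall_sum_mul_pow_eq_zero {X : Type*} [DecidableEq X] {S : Finset X}
    {z α : X → ℂ} (hz : Set.InjOn z S) (h : ∀ n : ℕ, ∑ p ∈ S, α p * z p ^ n = 0) {p : X}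
    (hp : p ∈ S) : α p = 0 := by
  have hpoly : ∀ P : Polynomial ℂ, ∑ p ∈ S, α p * P.eval (z p) = 0 := by
    intro P
    induction P using Polynomial.induction_on' with
    | add P Q hP hQ => simp only [Polynomial.eval_add, mul_add, Finset.sum_add_distrib, hP, hQ,
        add_zero]
    | monomial n w =>
      simp only [Polynomial.eval_monomial, mul_left_comm _ w, ← Finset.mul_sum, h, mul_zero]
  have := hpoly (Lagrange.basis S z p)
  rwa [Finset.sum_eq_single_of_mem p hp, Lagrange.eval_basis_self hz hp, mul_one] at this
  intro p' hp' hne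
  rw [Lagrange.eval_basis_of_ne hne.symm hp', mul_zero]

theorem zpow_injective_of_not_rootOfUnity {l : ℂ} (hl : l ≠ 0)
    (hroot : ∀ n : ℕ, n ≠ 0 → (l ^ 2) ^ n ≠ 1) : Function.Injective fun j : ℤ => l ^ j := by
  intro i j hij
  by_contra hne
  have h : l ^ (i - j) = 1 := by
    rw [zpow_sub₀ hl, show l ^ i = l ^ j from hij, div_self (zpow_ne_zero j hl)]
  have hnat : l ^ (i - j).natAbs = 1 := by
    rcases Int.natAbs_eq (i - j) with habs | habs
    · rwa [habs, zpow_natCast] at h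
    · rwa [habs, zpow_neg, zpow_natCast, inv_eq_one] at h
  exact hroot (i - j).natAbs (by omega) (by rw [pow_right_comm, hnat, one_pow])

namespace IsStandardPairing

variable {H A : Type*} [Ring H] [Algebra ℂ H] [Ring A] [Algebra ℂ A] {l μ : ℂ}
  {B : H →ₗ[ℂ] Module.Dual ℂ A} {ΔA : A →ₐ[ℂ] (A ⊗[ℂ] A)} {E F : H} {K : Hˣ} {a b c d : A}

theorem eq_zero_of_forall_right (h : IsStandardPairing l μ B ΔA E F K a b c d)
    (hH : IsUqGenerated (l ^ 2) E F K) (hA : IsSLqGenerated (l ^ 2) a b c d) (hl : l ≠ 0)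
    (hμ : μ ≠ 0) (hroot : ∀ n : ℕ, n ≠ 0 → (l ^ 2) ^ n ≠ 1) (hq : l ^ 2 - (l ^ 2)⁻¹ ≠ 0) {x : H}
    (hx : ∀ f, B x f = 0) : x = 0 := by
  obtain ⟨α, rfl⟩ := Finsupp.mem_span_range_iff_exists_finsupp.mp
    (hH.span_eq_top (pow_ne_zero 2 hl) hq ▸ Submodule.mem_top : x ∈ Submodule.span ℂ _)
  suffices hα : α = 0 by simp [hα]
  by_contra hα
  obtain ⟨⟨i, j, k⟩, hp, hmax⟩ := Finset.exists_max_image α.support Prod.fst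
    (Finsupp.support_nonempty_iff.mpr hα)
  refine Finsupp.mem_support_iff.mp hp (eq_zero_of_forall_sum_mul_pow_eq_zero
    (S := {p ∈ α.support | p.1 = i ∧ p.2.2 = k}) (z := fun p => l ^ p.2.1) ?_ (fun n => ?_)
    (by simpa using hp))
  · rintro ⟨i₁, j₁, k₁⟩ h₁ ⟨i₂, j₂, k₂⟩ h₂ h₁₂
    simp only [Finset.coe_filter, Set.mem_ofPred_eq] at h₁ h₂
    rw [h₁.2.1, h₁.2.2, h₂.2.1, h₂.2.2,
      show j₁ = j₂ from zpow_injective_of_not_rootOfUnity hl hroot h₁₂]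
  · obtain ⟨C, hC, hval⟩ := h.exists_monomial_eq hA hl hμ hroot i (n - i - k) k
    have := hx (c ^ i * diagPow a d (n - i - k) * b ^ k)
    rw [Finsupp.sum, map_sum, LinearMap.sum_apply, Finset.sum_congr rfl (fun p hp => by
      rw [map_smul, LinearMap.smul_apply, hval p.1 (hmax p hp), smul_eq_mul, mul_ite, mul_zero,
        show (i : ℤ) + (n - i - k) + k = n by ring, zpow_natCast, mul_left_comm]),
      ← Finset.sum_filter, ← Finset.mul_sum, mul_eq_zero, or_iff_right hC] at this
    exact this

theorem eq_zero_of_forall_left (h : IsStandardPairing l μ B ΔA E F K a b c d)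
    (hA : IsSLqGenerated (l ^ 2) a b c d) (hl : l ≠ 0)
    (hμ : μ ≠ 0) (hroot : ∀ n : ℕ, n ≠ 0 → (l ^ 2) ^ n ≠ 1) {f : A}
    (hf : ∀ x, B x f = 0) : f = 0 := by
  obtain ⟨α, rfl⟩ := Finsupp.mem_span_range_iff_exists_finsupp.mp
    (hA.span_eq_top (pow_ne_zero 2 hl) ▸ Submodule.mem_top : f ∈ Submodule.span ℂ _)
  suffices hα : α = 0 by simp [hα]
  by_contra hα
  obtain ⟨⟨r, s, t⟩, hp, hmin⟩ := Finset.exists_min_image α.support Prod.fst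
    (Finsupp.support_nonempty_iff.mpr hα)
  choose C hC hval using fun p : ℕ × ℤ × ℕ => h.exists_monomial_eq hA hl hμ hroot p.1 p.2.1 p.2.2
  have hzero := eq_zero_of_forall_sum_mul_pow_eq_zero
    (S := {p ∈ α.support | r = p.1 ∧ t = p.2.2}) (z := fun p => l ^ ((p.1 : ℤ) + p.2.1 + p.2.2))
    (α := fun p => α p * C p) (p := (r, s, t)) ?_ (fun n => ?_) (by simpa using hp)
  · exact mul_ne_zero (Finsupp.mem_support_iff.mp hp) (hC _) hzero
  · rintro ⟨r₁, s₁, t₁⟩ h₁ ⟨r₂, s₂, t₂⟩ h₂ h₁₂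
    simp only [Finset.coe_filter, Set.mem_ofPred_eq] at h₁ h₂
    have := zpow_injective_of_not_rootOfUnity hl hroot h₁₂
    obtain ⟨-, rfl, rfl⟩ := h₁
    obtain ⟨-, rfl, rfl⟩ := h₂
    simpa using this
  · have := hf (F ^ r * ↑(K ^ (n : ℤ)) * E ^ t)
    rw [Finsupp.sum, map_sum, Finset.sum_congr rfl (fun p hp => by
      rw [map_smul, hval p r (hmin p hp), smul_eq_mul, mul_ite, mul_zero, zpow_comm,
        zpow_natCast, ← mul_assoc]), ← Finset.sum_filter] at this
    exact this

end IsStandardPairing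

/-! ### The generators of `U_q(sl2)` and `SL_q(2,ℂ)` -/

/-- The generator `K` of `U_q(sl2)` as a unit. -/
def uqK (q : ℂ) : (Uq q)ˣ := ⟨ugen q 2, ugen q 3, ugen_K_mul_Kinv q, ugen_Kinv_mul_K q⟩

theorem isUqGenerated_ugen (q : ℂ) : IsUqGenerated q (ugen q 0) (ugen q 1) (uqK q) where
  K_mul_E := ugen_K_mul_E q
  K_mul_F := ugen_K_mul_F q
  commutator := ugen_E_F_commutator q
  adjoin_eq_top := by
    rw [Algebra.eq_top_iff]
    refine ringQuot_freeAlgebra_induction (fun z => Subalgebra.algebraMap_mem _ z) (fun i => ?_)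
      (fun _ _ => Subalgebra.mul_mem _) (fun _ _ => Subalgebra.add_mem _)
    apply Algebra.subset_adjoin
    fin_cases i
    exacts [.inl rfl, .inr (.inl rfl), .inr (.inr (.inl rfl)), .inr (.inr (.inr rfl))]

theorem isSLqGenerated_agen (q : ℂ) :
    IsSLqGenerated q (agen q 0) (agen q 1) (agen q 2) (agen q 3) where
  a_mul_b := agen_a_mul_b q
  a_mul_c := agen_a_mul_c q
  b_mul_d := agen_b_mul_d q
  c_mul_d := agen_c_mul_d q
  b_mul_c := agen_b_mul_c q
  a_mul_d := agen_a_mul_d q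
  d_mul_a := agen_d_mul_a q
  adjoin_eq_top := by
    rw [Algebra.eq_top_iff]
    refine ringQuot_freeAlgebra_induction (fun z => Subalgebra.algebraMap_mem _ z) (fun i => ?_)
      (fun _ _ => Subalgebra.mul_mem _) (fun _ _ => Subalgebra.add_mem _)
    apply Algebra.subset_adjoin
    fin_cases i
    exacts [.inl rfl, .inr (.inl rfl), .inr (.inr (.inl rfl)), .inr (.inr (.inr rfl))]

theorem isStandardPairing_of_isDualPairing {l μ : ℂ}
    {ΔH : Uq (l ^ 2) →ₐ[ℂ] (Uq (l ^ 2) ⊗[ℂ] Uq (l ^ 2))} {εH : Uq (l ^ 2) →ₐ[ℂ] ℂ}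
    {ΔA : SLq (l ^ 2) →ₐ[ℂ] (SLq (l ^ 2) ⊗[ℂ] SLq (l ^ 2))} {εA : SLq (l ^ 2) →ₐ[ℂ] ℂ}
    (hΔH : IsUComul (l ^ 2) ΔH) (hεH : IsUCounit (l ^ 2) εH)
    (hΔA : IsAComul (l ^ 2) ΔA) (hεA : IsACounit (l ^ 2) εA)
    {B : Uq (l ^ 2) →ₗ[ℂ] Module.Dual ℂ (SLq (l ^ 2))} (hB : IsDualPairing B ΔH εH ΔA εA)
    (hv : ∀ i j : Fin 4, B (ugen (l ^ 2) i) (agen (l ^ 2) j) = vals l μ i j) :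
    IsStandardPairing l μ B ΔA (ugen (l ^ 2) 0) (ugen (l ^ 2) 1) (uqK (l ^ 2))
      (agen (l ^ 2) 0) (agen (l ^ 2) 1) (agen (l ^ 2) 2) (agen (l ^ 2) 3) := by
  obtain ⟨hmul, hmul', hone, hone'⟩ := hB
  have hK : (uqK (l ^ 2) : Uq (l ^ 2)) = ugen (l ^ 2) 2 := rfl
  have hKinv : (↑(uqK (l ^ 2))⁻¹ : Uq (l ^ 2)) = ugen (l ^ 2) 3 := rfl
  obtain ⟨hE, hF, hK₂, hK₃⟩ := hΔH
  obtain ⟨eE, eF, eK, eK'⟩ := hεH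
  obtain ⟨ha, hb, hc, hd⟩ := hΔA
  obtain ⟨ea, eb, ec, ed⟩ := hεA
  exact
    { mul_left := hmul
      character_one := ⟨fun f g => by simp only [hone, map_mul], by rw [hone, map_one]⟩
      character_K := ⟨fun f g => by rw [hK, hmul', hK₂, pair2_tmul_tmul], by rw [hK, hone', eK]⟩
      character_Kinv :=
        ⟨fun f g => by rw [hKinv, hmul', hK₃, pair2_tmul_tmul], by rw [hKinv, hone', eK']⟩
      E_mul := fun f g => by
        rw [hK, hKinv, hmul', hE, map_add, LinearMap.add_apply, pair2_tmul_tmul, pair2_tmul_tmul]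
      F_mul := fun f g => by
        rw [hK, hKinv, hmul', hF, map_add, LinearMap.add_apply, pair2_tmul_tmul, pair2_tmul_tmul]
      E_one := (hone' _).trans eE
      F_one := (hone' _).trans eF
      comul_a := ha
      comul_b := hb
      comul_c := hc
      comul_d := hd
      one_gen := by simp only [hone, ea, eb, ec, ed, and_self]
      E_gen := ⟨hv 0 0, hv 0 1, hv 0 2, hv 0 3⟩
      F_gen := ⟨hv 1 0, hv 1 1, hv 1 2, hv 1 3⟩
      K_gen := ⟨hv 2 0, hv 2 1, hv 2 2, hv 2 3⟩
      Kinv_gen := ⟨hv 3 0, hv 3 1, hv 3 2, hv 3 3⟩ }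

/-- For `λ ∉ {0,1,−1}`, `q = λ²` not a root of unity, and `μ ≠ 0`, there is a unique
dual pairing of Hopf algebras between `U_q(sl2)` and `SL_q(2,ℂ)` with the prescribed
values on the generators; it is compatible with the antipodes and nondegenerate. -/
theorem standard_pairing_exists_unique (l μ : ℂ)
    (hl : l ≠ 0 ∧ l ≠ 1 ∧ l ≠ -1) (hμ : μ ≠ 0)
    (hroot : ∀ n : ℕ, n ≠ 0 → (l ^ 2) ^ n ≠ 1)
    (ΔH : Uq (l ^ 2) →ₐ[ℂ] (Uq (l ^ 2) ⊗[ℂ] Uq (l ^ 2))) (εH : Uq (l ^ 2) →ₐ[ℂ] ℂ)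
    (SH : Uq (l ^ 2) →ₗ[ℂ] Uq (l ^ 2))
    (ΔA : SLq (l ^ 2) →ₐ[ℂ] (SLq (l ^ 2) ⊗[ℂ] SLq (l ^ 2))) (εA : SLq (l ^ 2) →ₐ[ℂ] ℂ)
    (SA : SLq (l ^ 2) →ₗ[ℂ] SLq (l ^ 2))
    (hΔH : IsUComul (l ^ 2) ΔH) (hεH : IsUCounit (l ^ 2) εH)
    (hSH : IsUAntipode (l ^ 2) SH)
    (hΔA : IsAComul (l ^ 2) ΔA) (hεA : IsACounit (l ^ 2) εA)
    (hSA : IsAAntipode (l ^ 2) SA) :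
    (∃! B : Uq (l ^ 2) →ₗ[ℂ] Module.Dual ℂ (SLq (l ^ 2)),
      IsDualPairing B ΔH εH ΔA εA ∧
      (∀ i j : Fin 4, B (ugen (l ^ 2) i) (agen (l ^ 2) j) = vals l μ i j)) ∧
    (∀ B : Uq (l ^ 2) →ₗ[ℂ] Module.Dual ℂ (SLq (l ^ 2)),
      IsDualPairing B ΔH εH ΔA εA ∧
      (∀ i j : Fin 4, B (ugen (l ^ 2) i) (agen (l ^ 2) j) = vals l μ i j) →
        (∀ (x : Uq (l ^ 2)) (f : SLq (l ^ 2)), B (SH x) f = B x (SA f)) ∧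
        (∀ x : Uq (l ^ 2), (∀ f : SLq (l ^ 2), B x f = 0) → x = 0) ∧
        (∀ f : SLq (l ^ 2), (∀ x : Uq (l ^ 2), B x f = 0) → f = 0)) := by
  have hl₀ := hl.1
  have hq : l ^ 2 - (l ^ 2)⁻¹ ≠ 0 := by
    intro h
    refine hroot 2 two_ne_zero ?_
    rw [sq (l ^ 2)]
    nth_rw 1 [sub_eq_zero.mp h]
    exact inv_mul_cancel₀ (pow_ne_zero 2 hl₀)
  refine ⟨?_, fun B ⟨hB, hv⟩ => ?_⟩
  · obtain ⟨B, hB, hv⟩ := exists_dualPairing hl₀ hμ hΔH hεH hΔA hεA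
    exact ⟨B, ⟨hB, hv⟩, fun B' ⟨hB', hv'⟩ =>
      dualPairing_ext hΔH hB' hB fun i j => (hv' i j).trans (hv i j).symm⟩
  · have h := isStandardPairing_of_isDualPairing hΔH hεH hΔA hεA hB hv
    exact ⟨dualPairing_antipode hl₀ hΔH hεH hSH hΔA hεA hSA hB hv,
      fun x => h.eq_zero_of_forall_right (isUqGenerated_ugen _) (isSLqGenerated_agen _) hl₀ hμ
        hroot hq,
      fun f => h.eq_zero_of_forall_left (isSLqGenerated_agen _) hl₀ hμ hroot⟩
end
end

section
/- Let q, ℓ be nonzero complex numbers. Writing y₁₁ = a', y₁₂ = b', y₂₁ = c', y₂₂ = d' and σ₁₁ = d, σ₁₂ = −qb, σ₂₁ = −q⁻¹c, σ₂₂ = a (the entrywise antipode of the chiral matrix), there exists a unique ℂ-algebra homomorphism ρ : M^{ℓ,q} → L_{q,ℓ} ⊗ M^{ℓ,q} with ρ(t_{ij}) = Σ_{s,r=1,2} y_{is}·σ_{rj} ⊗ t_{sr} for all i, j ∈ {1,2}. Moreover ρ preserves the quantum metric: ρ(Q_{ℓ/q}) = 1 ⊗ Q_{ℓ/q}, where Q_{ℓ/q}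 = t₁₂t₂₁ − q⁻¹ℓ·t₁₁t₂₂. -/
noncomputable section

open FreeAlgebra
open scoped TensorProduct

/-- The relations of the q-linked complex Lorentz algebra `L_{q,ℓ}`: generators
`a = ι ℂ 0, b = ι ℂ 1, c = ι ℂ 2, d = ι ℂ 3` and `a' = ι ℂ 4, b' = ι ℂ 5,
c' = ι ℂ 6, d' = ι ℂ 7`, Manin relations with parameter `q` in both sectors, the
link relations, the commutation relations, and the determinant relations. -/
inductive LRel (q ℓ : ℂ) : FreeAlgebra ℂ (Fin 8) → FreeAlgebra ℂ (Fin 8) → Prop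
  | ab : LRel q ℓ (ι ℂ 0 * ι ℂ 1) (q⁻¹ • (ι ℂ 1 * ι ℂ 0))
  | ac : LRel q ℓ (ι ℂ 0 * ι ℂ 2) (q⁻¹ • (ι ℂ 2 * ι ℂ 0))
  | bd : LRel q ℓ (ι ℂ 1 * ι ℂ 3) (q⁻¹ • (ι ℂ 3 * ι ℂ 1))
  | cd : LRel q ℓ (ι ℂ 2 * ι ℂ 3) (q⁻¹ • (ι ℂ 3 * ι ℂ 2))
  | bc : LRel q ℓ (ι ℂ 1 * ι ℂ 2) (ι ℂ 2 * ι ℂ 1)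
  | ad : LRel q ℓ (ι ℂ 0 * ι ℂ 3 - ι ℂ 3 * ι ℂ 0) ((q⁻¹ - q) • (ι ℂ 1 * ι ℂ 2))
  | ab' : LRel q ℓ (ι ℂ 4 * ι ℂ 5) (q⁻¹ • (ι ℂ 5 * ι ℂ 4))
  | ac' : LRel q ℓ (ι ℂ 4 * ι ℂ 6) (q⁻¹ • (ι ℂ 6 * ι ℂ 4))
  | bd' : LRel q ℓ (ι ℂ 5 * ι ℂ 7) (q⁻¹ • (ι ℂ 7 * ι ℂ 5))
  | cd' : LRel q ℓ (ι ℂ 6 * ι ℂ 7) (q⁻¹ • (ι ℂ 7 * ι ℂ 6))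
  | bc' : LRel q ℓ (ι ℂ 5 * ι ℂ 6) (ι ℂ 6 * ι ℂ 5)
  | ad' : LRel q ℓ (ι ℂ 4 * ι ℂ 7 - ι ℂ 7 * ι ℂ 4) ((q⁻¹ - q) • (ι ℂ 5 * ι ℂ 6))
  | link₁ : LRel q ℓ (ι ℂ 5 * ι ℂ 0) (ℓ • (ι ℂ 0 * ι ℂ 5))
  | link₂ : LRel q ℓ (ι ℂ 0 * ι ℂ 6) (ℓ • (ι ℂ 6 * ι ℂ 0))
  | link₃ : LRel q ℓ (ι ℂ 4 * ι ℂ 1) (ℓ • (ι ℂ 1 * ι ℂ 4))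
  | link₄ : LRel q ℓ (ι ℂ 1 * ι ℂ 7) (ℓ • (ι ℂ 7 * ι ℂ 1))
  | link₅ : LRel q ℓ (ι ℂ 2 * ι ℂ 4) (ℓ • (ι ℂ 4 * ι ℂ 2))
  | link₆ : LRel q ℓ (ι ℂ 7 * ι ℂ 2) (ℓ • (ι ℂ 2 * ι ℂ 7))
  | link₇ : LRel q ℓ (ι ℂ 3 * ι ℂ 5) (ℓ • (ι ℂ 5 * ι ℂ 3))
  | link₈ : LRel q ℓ (ι ℂ 6 * ι ℂ 3) (ℓ • (ι ℂ 3 * ι ℂ 6))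
  | comm₁ : LRel q ℓ (ι ℂ 0 * ι ℂ 4) (ι ℂ 4 * ι ℂ 0)
  | comm₂ : LRel q ℓ (ι ℂ 0 * ι ℂ 7) (ι ℂ 7 * ι ℂ 0)
  | comm₃ : LRel q ℓ (ι ℂ 1 * ι ℂ 5) (ι ℂ 5 * ι ℂ 1)
  | comm₄ : LRel q ℓ (ι ℂ 1 * ι ℂ 6) (ι ℂ 6 * ι ℂ 1)
  | comm₅ : LRel q ℓ (ι ℂ 2 * ι ℂ 5) (ι ℂ 5 * ι ℂ 2)
  | comm₆ : LRel q ℓ (ι ℂ 2 * ι ℂ 6) (ι ℂ 6 * ι ℂ 2)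
  | comm₇ : LRel q ℓ (ι ℂ 3 * ι ℂ 4) (ι ℂ 4 * ι ℂ 3)
  | comm₈ : LRel q ℓ (ι ℂ 3 * ι ℂ 7) (ι ℂ 7 * ι ℂ 3)
  | det : LRel q ℓ (ι ℂ 0 * ι ℂ 3 - q⁻¹ • (ι ℂ 1 * ι ℂ 2)) 1
  | det' : LRel q ℓ (ι ℂ 4 * ι ℂ 7 - q⁻¹ • (ι ℂ 5 * ι ℂ 6)) 1

/-- The q-linked complex Lorentz algebra `L_{q,ℓ}`. -/
abbrev LAlg (q ℓ : ℂ) := RingQuot (LRel q ℓ)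

/-- The images of the eight generators of `L_{q,ℓ}`. -/
def lgen (q ℓ : ℂ) (i : Fin 8) : LAlg q ℓ :=
  RingQuot.mkAlgHom ℂ (LRel q ℓ) (ι ℂ i)

/-- The relations of the complex q-linked Minkowski algebra `M^{ℓ,q}`, with
generators `t₁₁ = ι ℂ 0`, `t₁₂ = ι ℂ 1`, `t₂₁ = ι ℂ 2`, `t₂₂ = ι ℂ 3`. -/
inductive MRel (q ℓ : ℂ) : FreeAlgebra ℂ (Fin 4) → FreeAlgebra ℂ (Fin 4) → Prop
  | r₁ : MRel q ℓ (ι ℂ 0 * ι ℂ 1) ((q * ℓ) • (ι ℂ 1 * ι ℂ 0))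
  | r₂ : MRel q ℓ (ι ℂ 1 * ι ℂ 3) ((q⁻¹ * ℓ) • (ι ℂ 3 * ι ℂ 1))
  | r₃ : MRel q ℓ (ι ℂ 0 * ι ℂ 2) ((q⁻¹ * ℓ⁻¹) • (ι ℂ 2 * ι ℂ 0))
  | r₄ : MRel q ℓ (ι ℂ 2 * ι ℂ 3) ((q * ℓ⁻¹) • (ι ℂ 3 * ι ℂ 2))
  | r₅ : MRel q ℓ (ι ℂ 0 * ι ℂ 3) (ι ℂ 3 * ι ℂ 0)
  | r₆ : MRel q ℓ (ι ℂ 1 * ι ℂ 2) (ι ℂ 2 * ι ℂ 1 + (ℓ * (q⁻¹ - q)) • (ι ℂ 0 * ι ℂ 3))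

/-- The complex q-linked Minkowski algebra `M^{ℓ,q}`. -/
abbrev MAlg (q ℓ : ℂ) := RingQuot (MRel q ℓ)

/-- The images of the generators `t₁₁, t₁₂, t₂₁, t₂₂` of `M^{ℓ,q}`. -/
def tgen (q ℓ : ℂ) (i : Fin 4) : MAlg q ℓ :=
  RingQuot.mkAlgHom ℂ (MRel q ℓ) (ι ℂ i)

/-- The matrix `(t_{ij})` of generators of `M^{ℓ,q}`. -/
def tmat (q ℓ : ℂ) : Fin 2 → Fin 2 → MAlg q ℓ :=
  ![![tgen q ℓ 0, tgen q ℓ 1], ![tgen q ℓ 2, tgen q ℓ 3]]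

/-- The quantum metric `Q_{ℓ/q} = t₁₂ t₂₁ − q⁻¹ℓ · t₁₁ t₂₂`. -/
def Qmetric (q ℓ : ℂ) : MAlg q ℓ :=
  tgen q ℓ 1 * tgen q ℓ 2 - (q⁻¹ * ℓ) • (tgen q ℓ 0 * tgen q ℓ 3)

/-- The antichiral matrix `(y_{ij}) = (a' b'; c' d')` of `L_{q,ℓ}`. -/
def ymat (q ℓ : ℂ) : Fin 2 → Fin 2 → LAlg q ℓ :=
  ![![lgen q ℓ 4, lgen q ℓ 5], ![lgen q ℓ 6, lgen q ℓ 7]]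

/-- The entrywise antipode `(σ_{ij}) = (d −qb; −q⁻¹c a)` of the chiral matrix of
`L_{q,ℓ}`. -/
def σmat (q ℓ : ℂ) : Fin 2 → Fin 2 → LAlg q ℓ :=
  ![![lgen q ℓ 3, (-q) • lgen q ℓ 1], ![(-q⁻¹) • lgen q ℓ 2, lgen q ℓ 0]]

/-- `ρ` is the coaction of `L_{q,ℓ}` on `M^{ℓ,q}`:
`ρ(t_{ij}) = Σ_{s,r} y_{is} σ_{rj} ⊗ t_{sr}`. -/
def IsCoaction (q ℓ : ℂ) (ρ : MAlg q ℓ →ₐ[ℂ] (LAlg q ℓ ⊗[ℂ] MAlg q ℓ)) : Prop :=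
  ∀ i j : Fin 2, ρ (tmat q ℓ i j) =
    ∑ s : Fin 2, ∑ r : Fin 2, (ymat q ℓ i s * σmat q ℓ r j) ⊗ₜ[ℂ] tmat q ℓ s r

/-- The relations of `L_{q,ℓ}` among eight elements of an arbitrary algebra, solved so that they
move the primed elements to the left of the unprimed ones and order each of the two sectors. -/
structure LorentzRelations (q ℓ : ℂ) {L : Type*} [Ring L] [Algebra ℂ L]
    (a b c d a' b' c' d' : L) : Prop where
  ab : a * b = q⁻¹ • (b * a)
  ac : a * c = q⁻¹ • (c * a)
  bd : b * d = q⁻¹ • (d * b)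
  cd : c * d = q⁻¹ • (d * c)
  bc : b * c = c * b
  ad : a * d = 1 + q⁻¹ • (c * b)
  da : d * a = 1 + q • (c * b)
  ab' : a' * b' = q⁻¹ • (b' * a')
  ac' : a' * c' = q⁻¹ • (c' * a')
  bd' : b' * d' = q⁻¹ • (d' * b')
  cd' : c' * d' = q⁻¹ • (d' * c')
  bc' : b' * c' = c' * b'
  ad' : a' * d' = 1 + q⁻¹ • (c' * b')
  da' : d' * a' = 1 + q • (c' * b')
  a_a' : a * a' = a' * a
  a_b' : a * b' = ℓ⁻¹ • (b' * a)
  a_c' : a * c' = ℓ • (c' * a)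
  a_d' : a * d' = d' * a
  b_a' : b * a' = ℓ⁻¹ • (a' * b)
  b_b' : b * b' = b' * b
  b_c' : b * c' = c' * b
  b_d' : b * d' = ℓ • (d' * b)
  c_a' : c * a' = ℓ • (a' * c)
  c_b' : c * b' = b' * c
  c_c' : c * c' = c' * c
  c_d' : c * d' = ℓ⁻¹ • (d' * c)
  d_a' : d * a' = a' * d
  d_b' : d * b' = ℓ • (b' * d)
  d_c' : d * c' = ℓ⁻¹ • (c' * d)
  d_d' : d * d' = d' * d

/-- The relations of `M^{ℓ,q}` among four elements of an arbitrary algebra. -/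
structure MinkowskiRelations (q ℓ : ℂ) {M : Type*} [Ring M] [Algebra ℂ M]
    (t₁₁ t₁₂ t₂₁ t₂₂ : M) : Prop where
  t₁₁_t₁₂ : t₁₁ * t₁₂ = (q * ℓ) • (t₁₂ * t₁₁)
  t₁₂_t₂₂ : t₁₂ * t₂₂ = (q⁻¹ * ℓ) • (t₂₂ * t₁₂)
  t₁₁_t₂₁ : t₁₁ * t₂₁ = (q⁻¹ * ℓ⁻¹) • (t₂₁ * t₁₁)
  t₂₁_t₂₂ : t₂₁ * t₂₂ = (q * ℓ⁻¹) • (t₂₂ * t₂₁)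
  t₁₁_t₂₂ : t₁₁ * t₂₂ = t₂₂ * t₁₁
  t₁₂_t₂₁ : t₁₂ * t₂₁ = t₂₁ * t₁₂ + (ℓ * (q⁻¹ - q)) • (t₁₁ * t₂₂)

lemma mul_mul_eq_of_mul_eq {R : Type*} [Semigroup R] {x y w : R} (h : x * y = w) (z : R) :
    x * (y * z) = w * z := by
  rw [← mul_assoc, h]

lemma eq_inv_smul_of_eq_smul {R : Type*} [Ring R] [Algebra ℂ R] {ℓ : ℂ} (hℓ : ℓ ≠ 0)
    {x y : R} (h : x = ℓ • y) : y = ℓ⁻¹ • x := by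
  rw [h, inv_smul_smul₀ hℓ]

lemma mul_eq_one_add_of_det {R : Type*} [Ring R] [Algebra ℂ R] {q : ℂ} {a b c d : R}
    (bc : b * c = c * b) (det : a * d - q⁻¹ • (b * c) = 1) : a * d = 1 + q⁻¹ • (c * b) := by
  rw [← bc, ← det, sub_add_cancel]

lemma mul_eq_one_add_of_manin {R : Type*} [Ring R] [Algebra ℂ R] {q : ℂ} {a b c d : R}
    (bc : b * c = c * b) (ad : a * d - d * a = (q⁻¹ - q) • (b * c))
    (det : a * d - q⁻¹ • (b * c) = 1) : d * a = 1 + q • (c * b) := by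
  rw [← bc, ← det, ← sub_sub_cancel (a * d) (d * a), ad]
  module

lemma lgen_relations (q ℓ : ℂ) (hℓ : ℓ ≠ 0) :
    LorentzRelations q ℓ (lgen q ℓ 0) (lgen q ℓ 1) (lgen q ℓ 2) (lgen q ℓ 3)
      (lgen q ℓ 4) (lgen q ℓ 5) (lgen q ℓ 6) (lgen q ℓ 7) := by
  have rel {x y : FreeAlgebra ℂ (Fin 8)} (h : LRel q ℓ x y) :
      RingQuot.mkAlgHom ℂ (LRel q ℓ) x = RingQuot.mkAlgHom ℂ (LRel q ℓ) y :=
    RingQuot.mkAlgHom_rel ℂ h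
  have bc := rel .bc
  have ad := rel .ad
  have det := rel .det
  have bc' := rel .bc'
  have ad' := rel .ad'
  have det' := rel .det'
  have link₁ := rel .link₁
  have link₃ := rel .link₃
  have link₆ := rel .link₆
  have link₈ := rel .link₈
  simp only [map_mul, map_sub, map_smul, map_one] at bc ad det bc' ad' det' link₁ link₃ link₆ link₈
  exact {
    ab := by simpa only [lgen, map_mul, map_smul] using rel .ab
    ac := by simpa only [lgen, map_mul, map_smul] using rel .ac
    bd := by simpa only [lgen, map_mul, map_smul] using rel .bd
    cd := by simpa only [lgen, map_mul, map_smul] using rel .cd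
    bc := bc
    ad := mul_eq_one_add_of_det bc det
    da := mul_eq_one_add_of_manin bc ad det
    ab' := by simpa only [lgen, map_mul, map_smul] using rel .ab'
    ac' := by simpa only [lgen, map_mul, map_smul] using rel .ac'
    bd' := by simpa only [lgen, map_mul, map_smul] using rel .bd'
    cd' := by simpa only [lgen, map_mul, map_smul] using rel .cd'
    bc' := bc'
    ad' := mul_eq_one_add_of_det bc' det'
    da' := mul_eq_one_add_of_manin bc' ad' det'
    a_a' := by simpa only [lgen, map_mul] using rel .comm₁
    a_b' := eq_inv_smul_of_eq_smul hℓ link₁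
    a_c' := by simpa only [lgen, map_mul, map_smul] using rel .link₂
    a_d' := by simpa only [lgen, map_mul] using rel .comm₂
    b_a' := eq_inv_smul_of_eq_smul hℓ link₃
    b_b' := by simpa only [lgen, map_mul] using rel .comm₃
    b_c' := by simpa only [lgen, map_mul] using rel .comm₄
    b_d' := by simpa only [lgen, map_mul, map_smul] using rel .link₄
    c_a' := by simpa only [lgen, map_mul, map_smul] using rel .link₅
    c_b' := by simpa only [lgen, map_mul] using rel .comm₅
    c_c' := by simpa only [lgen, map_mul] using rel .comm₆
    c_d' := eq_inv_smul_of_eq_smul hℓ link₆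
    d_a' := by simpa only [lgen, map_mul] using rel .comm₇
    d_b' := by simpa only [lgen, map_mul, map_smul] using rel .link₇
    d_c' := eq_inv_smul_of_eq_smul hℓ link₈
    d_d' := by simpa only [lgen, map_mul] using rel .comm₈ }

lemma tgen_relations (q ℓ : ℂ) :
    MinkowskiRelations q ℓ (tgen q ℓ 0) (tgen q ℓ 1) (tgen q ℓ 2) (tgen q ℓ 3) := by
  have rel {x y : FreeAlgebra ℂ (Fin 4)} (h : MRel q ℓ x y) :
      RingQuot.mkAlgHom ℂ (MRel q ℓ) x = RingQuot.mkAlgHom ℂ (MRel q ℓ) y :=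
    RingQuot.mkAlgHom_rel ℂ h
  exact {
    t₁₁_t₁₂ := by simpa only [tgen, map_mul, map_smul] using rel .r₁
    t₁₂_t₂₂ := by simpa only [tgen, map_mul, map_smul] using rel .r₂
    t₁₁_t₂₁ := by simpa only [tgen, map_mul, map_smul] using rel .r₃
    t₂₁_t₂₂ := by simpa only [tgen, map_mul, map_smul] using rel .r₄
    t₁₁_t₂₂ := by simpa only [tgen, map_mul] using rel .r₅
    t₁₂_t₂₁ := by simpa only [tgen, map_mul, map_add, map_smul] using rel .r₆ }

section Coaction

variable {q ℓ : ℂ} {L M : Type*} [Ring L] [Algebra ℂ L] [Ring M] [Algebra ℂ M]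
  {a b c d a' b' c' d' : L} {t₁₁ t₁₂ t₂₁ t₂₂ : M}

/-- The entry `Σ_{s,r} y_s σ_r ⊗ t_{sr}` of the coaction for a row `y` of the antichiral matrix and
a column `σ` of the antipode of the chiral matrix. -/
def coactionEntry (t₁₁ t₁₂ t₂₁ t₂₂ : M) (y₁ y₂ σ₁ σ₂ : L) : L ⊗[ℂ] M :=
  (y₁ * σ₁) ⊗ₜ t₁₁ + (y₁ * σ₂) ⊗ₜ t₁₂ + ((y₂ * σ₁) ⊗ₜ t₂₁ + (y₂ * σ₂) ⊗ₜ t₂₂)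

/-- The coaction entries satisfy the relations of `M^{ℓ,q}`, and their quantum metric is that of
`M^{ℓ,q}`. -/
lemma coactionEntry_relations_and_metric (hq : q ≠ 0) (hℓ : ℓ ≠ 0)
    (hL : LorentzRelations q ℓ a b c d a' b' c' d') (hM : MinkowskiRelations q ℓ t₁₁ t₁₂ t₂₁ t₂₂) :
    MinkowskiRelations q ℓ
      (coactionEntry t₁₁ t₁₂ t₂₁ t₂₂ a' b' d (-q⁻¹ • c))
      (coactionEntry t₁₁ t₁₂ t₂₁ t₂₂ a' b' (-q • b) a)
      (coactionEntry t₁₁ t₁₂ t₂₁ t₂₂ c' d' d (-q⁻¹ • c))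
      (coactionEntry t₁₁ t₁₂ t₂₁ t₂₂ c' d' (-q • b) a) ∧
      (coactionEntry t₁₁ t₁₂ t₂₁ t₂₂ a' b' (-q • b) a) *
          (coactionEntry t₁₁ t₁₂ t₂₁ t₂₂ c' d' d (-q⁻¹ • c)) -
        (q⁻¹ * ℓ) • ((coactionEntry t₁₁ t₁₂ t₂₁ t₂₂ a' b' d (-q⁻¹ • c)) *
          (coactionEntry t₁₁ t₁₂ t₂₁ t₂₂ c' d' (-q • b) a)) =
        1 ⊗ₜ[ℂ] (t₁₂ * t₂₁ - (q⁻¹ * ℓ) • (t₁₁ * t₂₂)) := by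
  refine ⟨⟨?_, ?_, ?_, ?_, ?_, ?_⟩, ?_⟩ <;> simp only [
    coactionEntry, mul_add, add_mul, Algebra.TensorProduct.tmul_mul_tmul, mul_assoc,
    smul_mul_assoc, mul_smul_comm, mul_one, one_mul, smul_add, TensorProduct.add_tmul,
    TensorProduct.tmul_add, ← TensorProduct.smul_tmul', TensorProduct.tmul_smul,
    TensorProduct.tmul_sub, hL.ab, hL.ac, hL.bd, hL.cd, hL.bc, hL.ad, hL.da, hL.ab', hL.ac',
    hL.bd', hL.cd', hL.bc', hL.ad', hL.da', mul_mul_eq_of_mul_eq hL.ab',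
    mul_mul_eq_of_mul_eq hL.ac', mul_mul_eq_of_mul_eq hL.bd', mul_mul_eq_of_mul_eq hL.cd',
    mul_mul_eq_of_mul_eq hL.bc', mul_mul_eq_of_mul_eq hL.ad', mul_mul_eq_of_mul_eq hL.da',
    mul_mul_eq_of_mul_eq hL.a_a', mul_mul_eq_of_mul_eq hL.a_b', mul_mul_eq_of_mul_eq hL.a_c',
    mul_mul_eq_of_mul_eq hL.a_d', mul_mul_eq_of_mul_eq hL.b_a', mul_mul_eq_of_mul_eq hL.b_b',
    mul_mul_eq_of_mul_eq hL.b_c', mul_mul_eq_of_mul_eq hL.b_d', mul_mul_eq_of_mul_eq hL.c_a',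
    mul_mul_eq_of_mul_eq hL.c_b', mul_mul_eq_of_mul_eq hL.c_c', mul_mul_eq_of_mul_eq hL.c_d',
    mul_mul_eq_of_mul_eq hL.d_a', mul_mul_eq_of_mul_eq hL.d_b', mul_mul_eq_of_mul_eq hL.d_c',
    mul_mul_eq_of_mul_eq hL.d_d', hM.t₁₁_t₁₂, hM.t₁₂_t₂₂, hM.t₁₁_t₂₁, hM.t₂₁_t₂₂, hM.t₁₁_t₂₂,
    hM.t₁₂_t₂₁]
  all_goals match_scalars <;> field_simp <;> ring

end Coaction

/-- There is a unique `ℂ`-algebra homomorphism `ρ : M^{ℓ,q} → L_{q,ℓ} ⊗ M^{ℓ,q}` with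
`ρ(t_{ij}) = Σ_{s,r} y_{is} σ_{rj} ⊗ t_{sr}`; moreover it preserves the quantum
metric:  `ρ(Q_{ℓ/q}) = 1 ⊗ Q_{ℓ/q}`. -/
theorem coaction_exists_unique (q ℓ : ℂ) (hq : q ≠ 0) (hℓ : ℓ ≠ 0) :
    (∃! ρ : MAlg q ℓ →ₐ[ℂ] (LAlg q ℓ ⊗[ℂ] MAlg q ℓ), IsCoaction q ℓ ρ) ∧
    (∀ ρ : MAlg q ℓ →ₐ[ℂ] (LAlg q ℓ ⊗[ℂ] MAlg q ℓ), IsCoaction q ℓ ρ →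
      ρ (Qmetric q ℓ) = 1 ⊗ₜ[ℂ] Qmetric q ℓ) := by
  have hL := lgen_relations q ℓ hℓ
  have hM := tgen_relations q ℓ
  let u : Fin 4 → LAlg q ℓ ⊗[ℂ] MAlg q ℓ := fun k =>
    coactionEntry (tgen q ℓ 0) (tgen q ℓ 1) (tgen q ℓ 2) (tgen q ℓ 3)
      (![lgen q ℓ 4, lgen q ℓ 4, lgen q ℓ 6, lgen q ℓ 6] k)
      (![lgen q ℓ 5, lgen q ℓ 5, lgen q ℓ 7, lgen q ℓ 7] k)
      (![lgen q ℓ 3, -q • lgen q ℓ 1, lgen q ℓ 3, -q • lgen q ℓ 1] k)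
      (![-q⁻¹ • lgen q ℓ 2, lgen q ℓ 0, -q⁻¹ • lgen q ℓ 2, lgen q ℓ 0] k)
  have hu : MinkowskiRelations q ℓ (u 0) (u 1) (u 2) (u 3) :=
    (coactionEntry_relations_and_metric hq hℓ hL hM).1
  have coaction_iff (ρ : MAlg q ℓ →ₐ[ℂ] (LAlg q ℓ ⊗[ℂ] MAlg q ℓ)) :
      IsCoaction q ℓ ρ ↔ ∀ k, ρ (tgen q ℓ k) = u k := by
    simp [IsCoaction, Fin.forall_fin_succ, tmat, ymat, σmat, u, coactionEntry, and_assoc]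
  refine ⟨⟨RingQuot.liftAlgHom ℂ ⟨FreeAlgebra.lift ℂ u, ?_⟩, ?_, ?_⟩, ?_⟩
  · rintro _ _ (_ | _ | _ | _ | _ | _) <;>
      simp only [map_mul, map_add, map_smul, FreeAlgebra.lift_ι_apply]
    exacts [hu.t₁₁_t₁₂, hu.t₁₂_t₂₂, hu.t₁₁_t₂₁, hu.t₂₁_t₂₂, hu.t₁₁_t₂₂, hu.t₁₂_t₂₁]
  · refine (coaction_iff _).2 ?_
    intro k
    rw [tgen, RingQuot.liftAlgHom_mkAlgHom_apply, FreeAlgebra.lift_ι_apply]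
  · intro ρ hρ
    rw [coaction_iff] at hρ
    refine RingQuot.ringQuot_ext' _ _ _ (FreeAlgebra.hom_ext (funext fun k => ?_))
    simpa [tgen] using hρ k
  · intro ρ hρ
    rw [coaction_iff] at hρ
    rw [Qmetric, map_sub, map_smul, map_mul, map_mul, hρ, hρ, hρ, hρ]
    exact (coactionEntry_relations_and_metric hq hℓ hL hM).2
end
end
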